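/- arXiv:2509.08508 — 12 statements merged into one kernel-verified Lean document; each statement's English description precedes it below -/
import Mathlib

section
/- Let V be a finite-dimensional vector space over a field of characteristic zero, N : V → V a nilpotent linear endomorphism, and n ≥ 0 an integer. Then there is at most one weight filtration of N centered at n: if W and W' are two increasing filtrations 0 = W_{-1} ⊆ W_0 ⊆ W_1 ⊆ ⋯ ⊆ W_{2n} = V, each satisfying N(W_ℓ) ⊆ W_{ℓ-2} for all ℓ and such that for every k ≥ 0 the induced map N^k : W_{n+k}/W_{n+k-1} → W_{n-k}/W_{n-k-1} is an isomorphism, then W_ℓ = W'_ℓ for all ℓ. -/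
/-- A weight filtration of a nilpotent endomorphism `N` centered at `n`:
an increasing filtration `W` with `W ℓ = ⊥` for `ℓ < 0`, `W ℓ = ⊤` for `ℓ ≥ 2n`,
`N (W ℓ) ⊆ W (ℓ - 2)`, and such that for every `k ≥ 0` the induced map
`N ^ k : W (n+k) / W (n+k-1) → W (n-k) / W (n-k-1)` is an isomorphism
(expressed by the injectivity and surjectivity of the induced map). -/
def IsWeightFiltration {K V : Type*} [Field K] [AddCommGroup V] [Module K V]
    (N : V →ₗ[K] V) (n : ℕ) (W : ℤ → Submodule K V) : Prop :=
  Monotone W ∧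
  (∀ ℓ : ℤ, ℓ < 0 → W ℓ = ⊥) ∧
  (∀ ℓ : ℤ, 2 * (n : ℤ) ≤ ℓ → W ℓ = ⊤) ∧
  (∀ ℓ : ℤ, ∀ v ∈ W ℓ, N v ∈ W (ℓ - 2)) ∧
  (∀ k : ℕ,
    (∀ v ∈ W ((n : ℤ) + k), (N ^ k) v ∈ W ((n : ℤ) - k - 1) → v ∈ W ((n : ℤ) + k - 1)) ∧
    (∀ w ∈ W ((n : ℤ) - k), ∃ v ∈ W ((n : ℤ) + k), (N ^ k) v - w ∈ W ((n : ℤ) - k - 1)))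

theorem wf_pow {K V : Type*} [Field K] [AddCommGroup V] [Module K V]
    (N : V →ₗ[K] V) (W : ℤ → Submodule K V)
    (h : ∀ ℓ : ℤ, ∀ v ∈ W ℓ, N v ∈ W (ℓ - 2)) (k : ℕ) :
    ∀ ℓ m : ℤ, m = ℓ - 2 * k → ∀ v ∈ W ℓ, (N ^ k) v ∈ W m := by
  induction k with
  | zero =>
    intro ℓ m hm v hv
    have : m = ℓ := by simpa using hm
    subst this
    simpa using hv
  | succ k ih =>
    intro ℓ m hm v hv
    rw [pow_succ, Module.End.mul_apply]
    exact ih (ℓ - 2) m (by push_cast at hm; omega) _ (h ℓ v hv)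

theorem wf_step {K V : Type*} [Field K] [AddCommGroup V] [Module K V]
    (N : V →ₗ[K] V) (n : ℕ) (W W' : ℤ → Submodule K V)
    (hW : IsWeightFiltration N n W) (hW' : IsWeightFiltration N n W') (k : ℕ)
    (h1 : W ((n : ℤ) + k) = W' ((n : ℤ) + k))
    (h2 : W ((n : ℤ) - k - 1) = W' ((n : ℤ) - k - 1)) :
    W ((n : ℤ) + k - 1) ≤ W' ((n : ℤ) + k - 1) ∧ W ((n : ℤ) - k) ≤ W' ((n : ℤ) - k) := by
  obtain ⟨mono, -, -, hN, hk⟩ := hW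
  obtain ⟨mono', -, -, hN', hk'⟩ := hW'
  constructor
  · intro v hv
    apply (hk' k).1 v
    · rw [← h1]
      exact mono (by omega) hv
    · rw [← h2]
      exact wf_pow N W hN k _ _ (by omega) v hv
  · intro w hw
    obtain ⟨v, hv, hd⟩ := (hk k).2 w hw
    rw [h1] at hv
    rw [h2] at hd
    have a := wf_pow N W' hN' k _ ((n : ℤ) - k) (by omega) v hv
    have b : (N ^ k) v - w ∈ W' ((n : ℤ) - k) := mono' (by omega) hd
    simpa using Submodule.sub_mem _ a b

/-- Uniqueness of the weight filtration of a nilpotent endomorphism centered at `n`. -/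
theorem weight_filtration_unique {K V : Type*} [Field K] [CharZero K]
    [AddCommGroup V] [Module K V] [FiniteDimensional K V]
    (N : V →ₗ[K] V) (hN : IsNilpotent N) (n : ℕ)
    (W W' : ℤ → Submodule K V)
    (hW : IsWeightFiltration N n W) (hW' : IsWeightFiltration N n W') :
    ∀ ℓ : ℤ, W ℓ = W' ℓ := by
  have key : ∀ j k : ℕ, n ≤ k + j →
      W ((n : ℤ) + k) = W' ((n : ℤ) + k) ∧ W ((n : ℤ) - k - 1) = W' ((n : ℤ) - k - 1) := by
    intro j
    induction j with
    | zero =>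
      intro k hk
      rw [hW.2.2.1 _ (by omega), hW'.2.2.1 _ (by omega), hW.2.1 _ (by omega),
        hW'.2.1 _ (by omega)]
      exact ⟨rfl, rfl⟩
    | succ j ih =>
      intro k hk
      obtain ⟨h1, h2⟩ := ih (k + 1) (by omega)
      obtain ⟨a, b⟩ := wf_step N n W W' hW hW' (k + 1) h1 h2
      obtain ⟨a', b'⟩ := wf_step N n W' W hW' hW (k + 1) h1.symm h2.symm
      have e1 : (n : ℤ) + ((k + 1 : ℕ) : ℤ) - 1 = n + k := by push_cast; ring
      have e2 : (n : ℤ) - ((k + 1 : ℕ) : ℤ) = n - k - 1 := by push_cast; ring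
      rw [e1] at a a'
      rw [e2] at b b'
      exact ⟨le_antisymm a a', le_antisymm b b'⟩
  intro ℓ
  rcases le_or_gt (n : ℤ) ℓ with h | h
  · have := (key n (ℓ - n).toNat (by omega)).1
    rwa [show (n : ℤ) + ((ℓ - n).toNat : ℤ) = ℓ by omega] at this
  · have := (key n (n - 1 - ℓ).toNat (by omega)).2
    rwa [show (n : ℤ) - ((n - 1 - ℓ).toNat : ℤ) - 1 = ℓ by omega] at this
end

section
/- Let V be a finite-dimensional vector space over a field of characteristic zero, N : V → V a nilpotent endomorphism, n ≥ 0 an integer, and W a weight filtration of N centered at n. If g : V → V is an invertible linear map commuting with N (g ∘ N = N ∘ g), then g preserves the weight filtration: g(W_ℓ) = W_ℓ for all ℓ. -/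
theorem wf_pow_mem {K V : Type*} [Field K] [AddCommGroup V] [Module K V]
    {N : V →ₗ[K] V} {W : ℤ → Submodule K V}
    (h : ∀ ℓ : ℤ, ∀ v ∈ W ℓ, N v ∈ W (ℓ - 2)) (k : ℕ) :
    ∀ ℓ : ℤ, ∀ v ∈ W ℓ, (N ^ k) v ∈ W (ℓ - 2 * k) := by
  induction k with
  | zero => intro ℓ v hv; simpa using hv
  | succ k ih =>
    intro ℓ v hv
    rw [pow_succ', Module.End.mul_apply]
    have := h _ _ (ih ℓ v hv)
    convert this using 2
    push_cast; ring

theorem wf_surj {K V : Type*} [Field K] [AddCommGroup V] [Module K V]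
    {N : V →ₗ[K] V} {n : ℕ} {W : ℤ → Submodule K V} (hW : IsWeightFiltration N n W) (d : ℕ) :
    ∀ k : ℕ, n + 1 ≤ k + d → ∀ w ∈ W ((n : ℤ) - k), ∃ u ∈ W ((n : ℤ) + k), (N ^ k) u = w := by
  obtain ⟨hm, h0, h1, h2, h3⟩ := hW
  induction d with
  | zero =>
    intro k hk w hw
    rw [h0 _ (by omega), Submodule.mem_bot] at hw
    exact ⟨0, Submodule.zero_mem _, by simp [hw]⟩
  | succ d ih =>
    intro k hk w hw
    obtain ⟨v, hv, hvw⟩ := (h3 k).2 w hw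
    obtain ⟨u, hu, huw⟩ := ih (k + 1) (by omega) _
      (by convert hvw using 2; push_cast; ring)
    refine ⟨v - N u, Submodule.sub_mem _ hv (hm ?_ (h2 _ _ hu)), ?_⟩
    · push_cast; omega
    · rw [pow_succ, Module.End.mul_apply] at huw
      rw [map_sub, huw]; abel

theorem wf_ker {K V : Type*} [Field K] [AddCommGroup V] [Module K V]
    {N : V →ₗ[K] V} {n : ℕ} {W : ℤ → Submodule K V} (hW : IsWeightFiltration N n W)
    (j : ℕ) (v : V) (hv : (N ^ j) v = 0) : v ∈ W ((n : ℤ) + j - 1) := by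
  obtain ⟨hm, h0, h1, h2, h3⟩ := hW
  have key : ∀ d : ℕ, v ∈ W ((n : ℤ) + (j + d : ℕ)) → v ∈ W ((n : ℤ) + j - 1) := by
    intro d
    induction d with
    | zero =>
      intro h
      exact (h3 j).1 v h (by rw [hv]; exact Submodule.zero_mem _)
    | succ d ih =>
      intro h
      apply ih
      have := (h3 (j + (d + 1))).1 v h (by
        rw [add_comm, pow_add, Module.End.mul_apply, hv, map_zero]; exact Submodule.zero_mem _)
      exact hm (by push_cast; omega) this
  apply key n
  rw [h1 _ (by push_cast; omega)]; trivial

theorem wf_le {K V : Type*} [Field K] [AddCommGroup V] [Module K V]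
    {N : V →ₗ[K] V} {n : ℕ} {W : ℤ → Submodule K V} (hW : IsWeightFiltration N n W)
    (g : V →ₗ[K] V) (hg : ∀ v : V, g (N v) = N (g v)) (ℓ : ℤ) : ∀ v ∈ W ℓ, g v ∈ W ℓ := by
  have hgk : ∀ (k : ℕ) (v : V), g ((N ^ k) v) = (N ^ k) (g v) := by
    intro k
    induction k with
    | zero => intro v; simp
    | succ k ih =>
      intro v
      rw [pow_succ, Module.End.mul_apply, Module.End.mul_apply, ih, hg]
  have hS := wf_surj hW
  have hK := wf_ker hW
  obtain ⟨hm, h0, h1, h2, h3⟩ := hW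
  have pos : ∀ d k : ℕ, n ≤ k + d → ∀ v ∈ W ((n : ℤ) + k), g v ∈ W ((n : ℤ) + k) := by
    intro d
    induction d with
    | zero =>
      intro k hk v hv
      rw [h1 _ (by omega)]; trivial
    | succ d ih =>
      intro k hk v hv
      have a := wf_pow_mem h2 (k + 1) _ v hv
      obtain ⟨u, hu, huv⟩ := hS (n + 1) (k + 2) (by omega) _
        (hm (by push_cast; omega) a)
      have b := ih (k + 2) (by omega) u hu
      have c : g (v - N u) ∈ W ((n : ℤ) + k) := by
        have := hK (k + 1) (g (v - N u)) (by
          rw [← hgk, map_sub, ← huv, pow_succ N (k + 1), Module.End.mul_apply, sub_self, map_zero])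
        exact hm (by push_cast; omega) this
      have e : g (N u) ∈ W ((n : ℤ) + k) := by
        rw [hg]
        exact hm (by push_cast; omega) (h2 _ _ b)
      have := Submodule.add_mem _ c e
      rwa [← map_add, sub_add_cancel] at this
  intro v hv
  rcases le_total (n : ℤ) ℓ with h | h
  · obtain ⟨k, rfl⟩ := Int.le.dest h
    exact pos n k (by omega) v hv
  · obtain ⟨k, hk⟩ := Int.le.dest h
    obtain rfl : ℓ = (n : ℤ) - k := by omega
    obtain ⟨u, hu, rfl⟩ := hS (n + 1) k (by omega) v hv
    rw [hgk]
    exact hm (by omega) (wf_pow_mem h2 k _ _ (pos n k (by omega) u hu))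

/-- An invertible linear map commuting with `N` preserves the weight filtration of `N`. -/
theorem weight_filtration_stable_under_centralizer {K V : Type*} [Field K] [CharZero K]
    [AddCommGroup V] [Module K V] [FiniteDimensional K V]
    (N : V →ₗ[K] V) (hN : IsNilpotent N) (n : ℕ)
    (W : ℤ → Submodule K V) (hW : IsWeightFiltration N n W)
    (g : V ≃ₗ[K] V) (hg : ∀ v : V, g (N v) = N (g v)) :
    ∀ ℓ : ℤ, Submodule.map (g : V →ₗ[K] V) (W ℓ) = W ℓ := by
  intro ℓ
  apply le_antisymm
  · rintro _ ⟨v, hv, rfl⟩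
    exact wf_le hW (g : V →ₗ[K] V) hg ℓ v hv
  · intro v hv
    refine ⟨g.symm v, wf_le hW (g.symm : V →ₗ[K] V) ?_ ℓ v hv, by simp⟩
    intro w
    apply g.injective
    simp [hg]
end

section
/- Let V be a finite-dimensional vector space over a field of characteristic zero, Q : V × V → k a nondegenerate bilinear form with Q(u,v) = (−1)^n Q(v,u) for all u,v, and N : V → V a nilpotent endomorphism satisfying Q(Nu,v) + Q(u,Nv) = 0 for all u,v. Let W be a weight filtration of N centered at n. Then for every ℓ with −1 ≤ ℓ ≤ 2n, the Q-orthogonal complement of W_ℓ equals W_{2n−1−ℓ}; in particular Q(W_ℓ, W_m) = 0 whenever ℓ + m ≤ 2n − 1, and Q induces a nondegenerate pairing between W_{n+k}/W_{n+k−1} and W_{n−k}/W_{n−k−1} for every k ≥ 0. -/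
theorem wfo_rank {K V V' : Type*} [Field K] [AddCommGroup V] [Module K V]
    [AddCommGroup V'] [Module K V'] [FiniteDimensional K V]
    (f : V →ₗ[K] V') (A B : Submodule K V) (hBA : B ≤ A)
    (hB : ∀ v ∈ A, f v = 0 ↔ v ∈ B) :
    Module.finrank K (A.map f) + Module.finrank K B = Module.finrank K A := by
  have h := LinearMap.finrank_range_add_finrank_ker (f.domRestrict A)
  rw [LinearMap.range_domRestrict] at h
  have e : Submodule.map A.subtype (LinearMap.ker (f.domRestrict A)) = B := by
    ext x
    simp only [Submodule.mem_map, LinearMap.mem_ker, LinearMap.domRestrict_apply]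
    constructor
    · rintro ⟨y, hy, rfl⟩
      exact (hB _ y.2).1 hy
    · intro hx
      exact ⟨⟨x, hBA hx⟩, (hB _ (hBA hx)).2 hx, rfl⟩
  rw [← Submodule.finrank_map_subtype_eq, e] at h
  exact h

theorem wfo_pow {K V : Type*} [Field K] [AddCommGroup V] [Module K V]
    (N : V →ₗ[K] V) (n : ℕ) (W : ℤ → Submodule K V) (hW : IsWeightFiltration N n W)
    (k : ℕ) : ∀ ℓ : ℤ, ∀ v ∈ W ℓ, (N ^ k) v ∈ W (ℓ - 2 * k) := by
  induction k with
  | zero => intro ℓ v hv; simpa using hv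
  | succ k ih =>
    intro ℓ v hv
    have h := hW.2.2.2.1 _ _ (ih ℓ v hv)
    rw [pow_succ', Module.End.mul_apply]
    convert h using 2
    push_cast; ring

theorem wfo_dim_step {K V : Type*} [Field K] [AddCommGroup V] [Module K V]
    [FiniteDimensional K V]
    (N : V →ₗ[K] V) (n : ℕ) (W : ℤ → Submodule K V) (hW : IsWeightFiltration N n W)
    (k : ℕ) : Module.finrank K (W (n + k)) + Module.finrank K (W (n - k - 1))
      = Module.finrank K (W (n + k - 1)) + Module.finrank K (W (n - k)) := by
  have hm := hW.1
  obtain ⟨hi, hs⟩ := hW.2.2.2.2 k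
  have h1 := wfo_rank ((W ((n : ℤ) - k - 1)).mkQ ∘ₗ (N ^ k)) (W (n + k)) (W (n + k - 1))
    (hm (by lia)) (by
      intro v hv
      simp only [LinearMap.comp_apply, Submodule.mkQ_apply, Submodule.Quotient.mk_eq_zero]
      refine ⟨hi v hv, fun h => ?_⟩
      exact hm (by lia) (wfo_pow N n W hW k _ v h))
  have h2 := wfo_rank (W ((n : ℤ) - k - 1)).mkQ (W (n - k)) (W (n - k - 1))
    (hm (by lia)) (by
      intro v hv
      simp only [Submodule.mkQ_apply, Submodule.Quotient.mk_eq_zero])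
  have e : (W ((n : ℤ) + k)).map ((W ((n : ℤ) - k - 1)).mkQ ∘ₗ (N ^ k))
      = (W ((n : ℤ) - k)).map (W ((n : ℤ) - k - 1)).mkQ := by
    apply le_antisymm
    · rintro _ ⟨v, hv, rfl⟩
      exact ⟨(N ^ k) v, hm (by lia) (wfo_pow N n W hW k _ v hv), rfl⟩
    · rintro _ ⟨w, hw, rfl⟩
      obtain ⟨v, hv, h⟩ := hs w hw
      exact ⟨v, hv, (Submodule.Quotient.eq _).2 h⟩
  rw [e] at h1
  lia

theorem wfo_dim {K V : Type*} [Field K] [AddCommGroup V] [Module K V]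
    [FiniteDimensional K V]
    (N : V →ₗ[K] V) (n : ℕ) (W : ℤ → Submodule K V) (hW : IsWeightFiltration N n W)
    (ℓ : ℤ) : Module.finrank K (W ℓ) + Module.finrank K (W (2 * n - 1 - ℓ))
      = Module.finrank K V := by
  have h0 : ∀ k : ℕ, Module.finrank K (W (n + k)) + Module.finrank K (W (n - k - 1))
      = Module.finrank K (W n) + Module.finrank K (W (n - 1)) := by
    intro k
    induction k with
    | zero => rw [Nat.cast_zero, add_zero, sub_zero]
    | succ k ih =>
      rw [wfo_dim_step N n W hW (k + 1), ← ih]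
      congr 4 <;> push_cast <;> ring_nf
  have h1 : ∀ k : ℕ, Module.finrank K (W (n + k)) + Module.finrank K (W (n - k - 1))
      = Module.finrank K V := by
    intro k
    rw [h0 k, ← h0 n, hW.2.1 (n - n - 1) (by lia), hW.2.2.1 (n + n) (by lia)]
    simp
  rcases le_or_gt (n : ℤ) ℓ with h | h
  · have := h1 (ℓ - n).toNat
    rw [Int.toNat_of_nonneg (by lia)] at this
    rw [← this]
    congr 4 <;> ring_nf
  · have := h1 (n - 1 - ℓ).toNat
    rw [Int.toNat_of_nonneg (by lia)] at this
    rw [← this, add_comm]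
    congr 4 <;> ring_nf

theorem wfo_orth {K V : Type*} [Field K] [AddCommGroup V] [Module K V]
    (n : ℕ) (Q : V →ₗ[K] V →ₗ[K] K)
    (hQsymm : ∀ u v : V, Q u v = (-1 : K) ^ n * Q v u)
    (N : V →ₗ[K] V)
    (hNQ : ∀ u v : V, Q (N u) v + Q u (N v) = 0)
    (W : ℤ → Submodule K V) (hW : IsWeightFiltration N n W) :
    ∀ ℓ m : ℤ, ℓ + m ≤ 2 * (n : ℤ) - 1 → ∀ u ∈ W ℓ, ∀ v ∈ W m, Q u v = 0 := by
  have hm := hW.1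
  have hpow : ∀ (k : ℕ) (u v : V), Q ((N ^ k) u) v = (-1 : K) ^ k * Q u ((N ^ k) v) := by
    intro k
    induction k with
    | zero => simp
    | succ k ih =>
      intro u v
      rw [pow_succ N k, Module.End.mul_apply, ih, ← pow_succ N k, pow_succ' N k, Module.End.mul_apply,
        eq_neg_of_add_eq_zero_left (hNQ u _)]
      ring
  have key : ∀ j : ℕ, j ≤ n → ∀ u ∈ W ((j : ℤ) - 1), ∀ v ∈ W (2 * (n : ℤ) - j), Q u v = 0 := by
    intro j
    induction j with
    | zero =>
      intro _ u hu v _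
      rw [hW.2.1 _ (by simp), Submodule.mem_bot] at hu
      simp [hu]
    | succ j ih =>
      intro hj u hu v hv
      have ih := ih (by lia)
      obtain ⟨k, rfl⟩ : ∃ k : ℕ, n = j + k := ⟨n - j, by lia⟩
      push_cast at *
      obtain ⟨u', hu', h⟩ := (hW.2.2.2.2 k).2 u (hm (by push_cast; lia) hu)
      push_cast at *
      have e : u = (N ^ k) u' - ((N ^ k) u' - u) := by abel
      have h2 := wfo_pow N _ W hW k _ v hv
      have a1 := ih _ (hm (by lia) h2) u' (hm (by lia) hu')
      have a2 := ih _ (hm (by lia) h) v (hm (by lia) hv)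
      rw [e, map_sub, LinearMap.sub_apply, a2, hpow, hQsymm, a1]
      simp
  have half : ∀ ℓ m : ℤ, ℓ ≤ n - 1 → ℓ + m ≤ 2 * (n : ℤ) - 1 →
      ∀ u ∈ W ℓ, ∀ v ∈ W m, Q u v = 0 := by
    intro ℓ m h h' u hu v hv
    by_cases h0 : ℓ < 0
    · rw [hW.2.1 _ h0, Submodule.mem_bot] at hu
      simp [hu]
    · exact key (ℓ + 1).toNat (by lia) u (hm (by lia) hu) v (hm (by lia) hv)
  intro ℓ m h u hu v hv
  by_cases h1 : ℓ ≤ n - 1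
  · exact half ℓ m h1 h u hu v hv
  · rw [hQsymm, half m ℓ (by lia) (by lia) v hv u hu, mul_zero]

/-- For a nondegenerate `(-1)^n`-symmetric bilinear form `Q` whose infinitesimal isometry
`N` is nilpotent with weight filtration `W` centered at `n`: the `Q`-orthogonal complement
of `W ℓ` is `W (2n - 1 - ℓ)`; in particular `Q (W ℓ, W m) = 0` for `ℓ + m ≤ 2n - 1`, and
`Q` induces a nondegenerate pairing between `Gr (n+k)` and `Gr (n-k)`. -/
theorem weight_filtration_orthogonality {K V : Type*} [Field K] [CharZero K]
    [AddCommGroup V] [Module K V] [FiniteDimensional K V]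
    (n : ℕ) (Q : V →ₗ[K] V →ₗ[K] K)
    (hQnondeg : ∀ u : V, (∀ v : V, Q u v = 0) → u = 0)
    (hQsymm : ∀ u v : V, Q u v = (-1 : K) ^ n * Q v u)
    (N : V →ₗ[K] V) (hN : IsNilpotent N)
    (hNQ : ∀ u v : V, Q (N u) v + Q u (N v) = 0)
    (W : ℤ → Submodule K V) (hW : IsWeightFiltration N n W) :
    (∀ ℓ : ℤ, -1 ≤ ℓ → ℓ ≤ 2 * (n : ℤ) →
      ∀ v : V, (∀ u ∈ W ℓ, Q u v = 0) ↔ v ∈ W (2 * (n : ℤ) - 1 - ℓ)) ∧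
    (∀ ℓ m : ℤ, ℓ + m ≤ 2 * (n : ℤ) - 1 → ∀ u ∈ W ℓ, ∀ v ∈ W m, Q u v = 0) ∧
    (∀ k : ℕ,
      (∀ u ∈ W ((n : ℤ) + k), (∀ v ∈ W ((n : ℤ) - k), Q u v = 0) → u ∈ W ((n : ℤ) + k - 1)) ∧
      (∀ v ∈ W ((n : ℤ) - k), (∀ u ∈ W ((n : ℤ) + k), Q u v = 0) → v ∈ W ((n : ℤ) - k - 1))) := by
  have horth := wfo_orth n Q hQsymm N hNQ W hW
  have hnd : Q.Nondegenerate := by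
    refine ⟨hQnondeg, fun v hv => hQnondeg v fun u => ?_⟩
    rw [hQsymm, hv, mul_zero]
  have hall : ∀ ℓ : ℤ, ∀ v : V, (∀ u ∈ W ℓ, Q u v = 0) ↔ v ∈ W (2 * (n : ℤ) - 1 - ℓ) := by
    intro ℓ v
    have hd := wfo_dim N n W hW ℓ
    have hf := LinearMap.BilinForm.finrank_orthogonal (B := Q) hnd (W ℓ)
    have e : W (2 * (n : ℤ) - 1 - ℓ) = LinearMap.BilinForm.orthogonal Q (W ℓ) := by
      apply Submodule.eq_of_le_of_finrank_eq
      · intro w hw u hu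
        exact horth _ _ (by lia) u hu w hw
      · lia
    rw [e]
    exact Iff.rfl
  refine ⟨fun ℓ _ _ => hall ℓ, horth, fun k => ⟨fun u _ h => ?_, fun v _ h => ?_⟩⟩
  · have := (hall (n - k) u).1 fun v hv => by rw [hQsymm, h v hv, mul_zero]
    convert this using 2
    ring
  · have := (hall (n + k) v).1 h
    convert this using 2
    ring
end

section
/- Let V be a finite-dimensional vector space over a field of characteristic zero, Q a nondegenerate (−1)^n-symmetric bilinear form on V, N a nilpotent infinitesimal isometry of Q, and W a weight filtration of N centered at n. Then for every k ≥ 0 the formula Q_k(ū, v̄) = Q(u, N^k v), for u, v ∈ W_{n+k} with images ū, v̄ in Gr_{n+k} = W_{n+k}/W_{n+k−1}, gives a well-defined bilinear form on Gr_{n+k} (independent of the choice of representatives), and Q_k is (−1)^{n+k}-symmetric: Q_k(ū,v̄) = (−1)^{n+k} Q_k(v̄,ū). -/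
theorem aux_Q_pow {K V : Type*} [Field K] [AddCommGroup V] [Module K V]
    (Q : V →ₗ[K] V →ₗ[K] K) (N : V →ₗ[K] V)
    (hNQ : ∀ u v : V, Q (N u) v + Q u (N v) = 0) (k : ℕ) :
    ∀ u v : V, Q ((N ^ k) u) v = (-1 : K) ^ k * Q u ((N ^ k) v) := by
  induction k with
  | zero => intro u v; simp
  | succ k ih =>
    intro u v
    have h1 : (N ^ (k + 1)) u = (N ^ k) (N u) := by rw [pow_succ]; rfl
    have h2 : (N ^ (k + 1)) v = N ((N ^ k) v) := by rw [pow_succ']; rfl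
    rw [h1, h2, ih, eq_neg_of_add_eq_zero_left (hNQ u ((N ^ k) v))]
    ring

theorem aux_W_pow {K V : Type*} [Field K] [AddCommGroup V] [Module K V]
    (N : V →ₗ[K] V) (W : ℤ → Submodule K V)
    (h : ∀ ℓ : ℤ, ∀ v ∈ W ℓ, N v ∈ W (ℓ - 2)) (k : ℕ) :
    ∀ ℓ : ℤ, ∀ v ∈ W ℓ, (N ^ k) v ∈ W (ℓ - 2 * k) := by
  induction k with
  | zero => intro l v hv; simpa using hv
  | succ k ih =>
    intro l v hv
    have h2 : (N ^ (k + 1)) v = N ((N ^ k) v) := by rw [pow_succ']; rfl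
    rw [h2]
    have := h _ _ (ih l v hv)
    convert this using 2
    push_cast; ring

theorem aux_orth {K V : Type*} [Field K] [AddCommGroup V] [Module K V]
    (n : ℕ) (Q : V →ₗ[K] V →ₗ[K] K)
    (hQsymm : ∀ u v : V, Q u v = (-1 : K) ^ n * Q v u)
    (N : V →ₗ[K] V) (hNQ : ∀ u v : V, Q (N u) v + Q u (N v) = 0)
    (W : ℤ → Submodule K V) (hW : IsWeightFiltration N n W) (m : ℕ) :
    ∀ a b : ℤ, a + b < 2 * n → (a < m ∨ b < m) → ∀ u ∈ W a, ∀ v ∈ W b, Q u v = 0 := by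
  obtain ⟨hmono, hbot, -, hN2, hiso⟩ := hW
  induction m with
  | zero =>
    rintro a b - (h | h) u hu v hv
    · rw [hbot a (by simpa using h), Submodule.mem_bot] at hu
      simp [hu]
    · rw [hbot b (by simpa using h), Submodule.mem_bot] at hv
      simp [hv]
  | succ m ih =>
    have H : ∀ a b : ℤ, a + b < 2 * n → a < (m : ℤ) + 1 →
        ∀ u ∈ W a, ∀ v ∈ W b, Q u v = 0 := by
      intro a b hab ham u hu v hv
      by_cases hbm : b < m
      · exact ih a b hab (Or.inr hbm) u hu v hv
      obtain ⟨j, hj⟩ : ∃ j : ℕ, a = (n : ℤ) - j := ⟨(n - a).toNat, by omega⟩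
      subst hj
      obtain ⟨x, hx, hxu⟩ := (hiso j).2 u hu
      have e1 := ih _ b (by omega) (Or.inl (by omega)) _ hxu v hv
      have e2 := ih _ _ (by omega) (Or.inr (by omega)) x hx _ (aux_W_pow N W hN2 j b v hv)
      rw [map_sub, LinearMap.sub_apply, aux_Q_pow Q N hNQ, e2] at e1
      simpa using e1
    rintro a b hab (h | h) u hu v hv
    · exact H a b hab (by simpa using h) u hu v hv
    · rw [hQsymm, H b a (by omega) (by simpa using h) v hv u hu, mul_zero]

/-- The formula `Q_k (ū, v̄) = Q (u, N^k v)` for `u, v ∈ W (n+k)` gives a well-defined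
bilinear form on `Gr (n+k) = W (n+k) / W (n+k-1)` (independent of representatives), and
it is `(-1)^(n+k)`-symmetric. -/
theorem weight_filtration_Qk_wellDefined_and_symmetric {K V : Type*} [Field K] [CharZero K]
    [AddCommGroup V] [Module K V] [FiniteDimensional K V]
    (n : ℕ) (Q : V →ₗ[K] V →ₗ[K] K)
    (hQnondeg : ∀ u : V, (∀ v : V, Q u v = 0) → u = 0)
    (hQsymm : ∀ u v : V, Q u v = (-1 : K) ^ n * Q v u)
    (N : V →ₗ[K] V) (hN : IsNilpotent N)
    (hNQ : ∀ u v : V, Q (N u) v + Q u (N v) = 0)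
    (W : ℤ → Submodule K V) (hW : IsWeightFiltration N n W) :
    ∀ k : ℕ,
      (∀ u u' v v' : V, u ∈ W ((n : ℤ) + k) → u' ∈ W ((n : ℤ) + k) →
        v ∈ W ((n : ℤ) + k) → v' ∈ W ((n : ℤ) + k) →
        u - u' ∈ W ((n : ℤ) + k - 1) → v - v' ∈ W ((n : ℤ) + k - 1) →
        Q u ((N ^ k) v) = Q u' ((N ^ k) v')) ∧
      (∀ u ∈ W ((n : ℤ) + k), ∀ v ∈ W ((n : ℤ) + k),
        Q u ((N ^ k) v) = (-1 : K) ^ (n + k) * Q v ((N ^ k) u)) := by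
  have orth : ∀ a b : ℤ, a + b < 2 * n → ∀ u ∈ W a, ∀ v ∈ W b, Q u v = 0 := by
    intro a b hab
    exact aux_orth n Q hQsymm N hNQ W hW (a.toNat + 1) a b hab (Or.inl (by omega))
  have hN2 := hW.2.2.2.1
  intro k
  constructor
  · intro u u' v v' hu hu' hv hv' huu hvv
    have e1 := orth _ _ (by omega) _ huu _ (aux_W_pow N W hN2 k _ v hv)
    have e2 := orth _ _ (by omega) _ hu' _ (aux_W_pow N W hN2 k _ _ hvv)
    rw [map_sub, LinearMap.sub_apply, sub_eq_zero] at e1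
    rw [map_sub, map_sub, sub_eq_zero] at e2
    rw [e1, e2]
  · intro u _ v _
    rw [hQsymm, aux_Q_pow Q N hNQ, pow_add, mul_assoc]
end

section
/- Let V be a finite-dimensional vector space over a field of characteristic zero, Q a nondegenerate (−1)^n-symmetric bilinear form on V, N a nilpotent infinitesimal isometry of Q, and W a weight filtration of N centered at n. For k ≥ 0 let P_{n+k} = ker(N^{k+1} : Gr_{n+k} → Gr_{n−k−2}) be the primitive subspace of Gr_{n+k} = W_{n+k}/W_{n+k−1} (where N also denotes the induced maps on graded quotients). Then the restriction to P_{n+k} of the bilinear form Q_k(ū,v̄) = Q(u, N^k v) on Gr_{n+k} is nondegenerate. -/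
theorem wf_rank {K V V' : Type*} [Field K] [AddCommGroup V] [Module K V] [FiniteDimensional K V]
    [AddCommGroup V'] [Module K V'] (g : V →ₗ[K] V') (p : Submodule K V) :
    Module.finrank K (p.map g) + Module.finrank K (p ⊓ LinearMap.ker g : Submodule K V)
      = Module.finrank K p := by
  have h := LinearMap.finrank_range_add_finrank_ker (g.domRestrict p)
  rw [← h, LinearMap.range_domRestrict]
  congr 1
  rw [← Submodule.finrank_map_subtype_eq p (LinearMap.ker (g.domRestrict p))]
  rw [LinearMap.ker_domRestrict]
  exact congrArg (fun q : Submodule K V => Module.finrank K q) (Submodule.map_comap_subtype p (LinearMap.ker g)).symm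

theorem wf_dim {K V : Type*} [Field K] [AddCommGroup V] [Module K V] [FiniteDimensional K V]
    (f : V →ₗ[K] V) (A A' B B' : Submodule K V) (hB : B' ≤ B)
    (h1 : ∀ v ∈ A, f v ∈ B) (h2 : ∀ v ∈ A, f v ∈ B' → v ∈ A') :
    Module.finrank K A + Module.finrank K B' ≤ Module.finrank K A' + Module.finrank K B := by
  have e1 := wf_rank (B'.mkQ ∘ₗ f) A
  have e2 := wf_rank B'.mkQ B
  have l1 : Module.finrank K (A.map (B'.mkQ ∘ₗ f)) ≤ Module.finrank K (B.map B'.mkQ) := by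
    apply Submodule.finrank_mono
    rintro _ ⟨v, hv, rfl⟩
    exact ⟨f v, h1 v hv, rfl⟩
  have l2 : Module.finrank K (A ⊓ LinearMap.ker (B'.mkQ ∘ₗ f) : Submodule K V)
      ≤ Module.finrank K A' := by
    apply Submodule.finrank_mono
    rintro v ⟨hv, hk⟩
    refine h2 v hv ?_
    simpa using hk
  rw [Submodule.ker_mkQ, inf_eq_right.mpr hB] at e2
  omega

/-- The restriction of the bilinear form `Q_k (ū, v̄) = Q (u, N^k v)` to the primitive
subspace `P (n+k) = ker (N^(k+1) : Gr (n+k) → Gr (n-k-2))` is nondegenerate.  An element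
`u ∈ W (n+k)` represents a class of `P (n+k)` exactly when `N^(k+1) u ∈ W (n-k-3)`, and
its class vanishes exactly when `u ∈ W (n+k-1)`. -/
theorem weight_filtration_Qk_nondegenerate_on_primitive {K V : Type*} [Field K] [CharZero K]
    [AddCommGroup V] [Module K V] [FiniteDimensional K V]
    (n : ℕ) (Q : V →ₗ[K] V →ₗ[K] K)
    (hQnondeg : ∀ u : V, (∀ v : V, Q u v = 0) → u = 0)
    (hQsymm : ∀ u v : V, Q u v = (-1 : K) ^ n * Q v u)
    (N : V →ₗ[K] V) (hN : IsNilpotent N)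
    (hNQ : ∀ u v : V, Q (N u) v + Q u (N v) = 0)
    (W : ℤ → Submodule K V) (hW : IsWeightFiltration N n W) :
    ∀ k : ℕ, ∀ u ∈ W ((n : ℤ) + k), (N ^ (k + 1)) u ∈ W ((n : ℤ) - k - 3) →
      (∀ v ∈ W ((n : ℤ) + k), (N ^ (k + 1)) v ∈ W ((n : ℤ) - k - 3) →
        Q u ((N ^ k) v) = 0) →
      u ∈ W ((n : ℤ) + k - 1) := by
  obtain ⟨hmono, hbot, htop, hNW, hiso⟩ := hW
  have hpow : ∀ (j : ℕ) (l : ℤ), ∀ v ∈ W l, (N ^ j) v ∈ W (l - 2 * j) := by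
    intro j
    induction j with
    | zero => intro l v hv; simpa using hv
    | succ j ih =>
      intro l v hv
      have := hNW _ _ (ih l v hv)
      rw [pow_succ', Module.End.mul_apply]
      convert this using 2
      push_cast; ring
  have hadj : ∀ (j : ℕ) (u v : V), Q u ((N ^ j) v) = (-1 : K) ^ j * Q ((N ^ j) u) v := by
    intro j
    induction j with
    | zero => intro u v; simp
    | succ j ih =>
      intro u v
      have h := hNQ ((N ^ j) u) v
      rw [pow_succ, Module.End.mul_apply, ih u (N v), ← pow_succ, pow_succ' N,
        Module.End.mul_apply, eq_neg_of_add_eq_zero_left h]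
      ring
  have hz : ∀ u v : V, Q u v = 0 → Q v u = 0 := by
    intro u v h
    rw [hQsymm, h, mul_zero]
  -- orthogonality
  have horth : ∀ d j : ℕ, n ≤ j + d → ∀ x ∈ W ((n : ℤ) + j), ∀ w ∈ W ((n : ℤ) - j - 1),
      Q x w = 0 := by
    intro d
    induction d with
    | zero =>
      intro j hj x hx w hw
      rw [hbot _ (by omega)] at hw
      rw [(Submodule.mem_bot K).1 hw, map_zero]
    | succ d ih =>
      intro j hj x hx w hw
      have ih' := ih (j + 1) (by omega)
      obtain ⟨y, hy, hyw⟩ := (hiso (j + 1)).2 w (by convert hw using 2; push_cast; ring)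
      have a1 : Q x ((N ^ (j + 1)) y - w) = 0 :=
        ih' x (hmono (by push_cast; omega) hx) _ hyw
      have a2 : Q ((N ^ (j + 1)) x) y = 0 := by
        apply hz
        apply ih' y hy
        have := hpow (j + 1) _ x hx
        refine hmono ?_ this
        push_cast; omega
      rw [map_sub, hadj, a2, mul_zero, zero_sub, neg_eq_zero] at a1
      exact a1
  have horth' : ∀ j : ℕ, ∀ x ∈ W ((n : ℤ) + j), ∀ w ∈ W ((n : ℤ) - j - 1), Q x w = 0 :=
    fun j => horth n j (by omega)
  -- dimensions
  have hdim : ∀ d k : ℕ, n + 1 ≤ k + d → Module.finrank K V ≤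
      Module.finrank K (W ((n : ℤ) + k - 1)) + Module.finrank K (W ((n : ℤ) - k)) := by
    intro d
    induction d with
    | zero =>
      intro k hk
      rw [htop ((n : ℤ) + k - 1) (by omega), finrank_top]
      omega
    | succ d ih =>
      intro k hk
      have h1 := ih (k + 1) (by omega)
      have h2 := wf_dim (N ^ k) (W ((n : ℤ) + k)) (W ((n : ℤ) + k - 1)) (W ((n : ℤ) - k))
        (W ((n : ℤ) - k - 1)) (hmono (by omega))
        (fun v hv => by
          have := hpow k _ v hv
          convert this using 2; ring) (hiso k).1
      have e1 : (n : ℤ) + (k + 1 : ℕ) - 1 = n + k := by push_cast; ring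
      have e2 : (n : ℤ) - (k + 1 : ℕ) = n - k - 1 := by push_cast; ring
      rw [e1, e2] at h1
      omega
  intro k u hu hpu huv
  -- u is orthogonal to W (n - k)
  have hA : ∀ v ∈ W ((n : ℤ) + k), Q u ((N ^ k) v) = 0 := by
    intro v hv
    have hv' : (N ^ (k + 1)) v ∈ W ((n : ℤ) - (k + 2 : ℕ)) := by
      have := hpow (k + 1) _ v hv
      convert this using 2; push_cast; ring
    obtain ⟨x, hx, hxw⟩ := (hiso (k + 2)).2 _ hv'
    have hNx : N x ∈ W ((n : ℤ) + k) := by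
      have := hNW _ x hx
      convert this using 2; push_cast; ring
    have b1 := huv (v - N x) (Submodule.sub_mem _ hv hNx) (by
      have h3 := Submodule.neg_mem _ hxw
      rw [neg_sub] at h3
      rw [map_sub, ← Module.End.mul_apply, ← pow_succ]
      convert h3 using 2; push_cast; ring)
    have b2 : Q ((N ^ (k + 1)) u) x = 0 := by
      apply hz
      refine horth' (k + 2) x hx _ ?_
      convert hpu using 2; push_cast; ring
    rw [map_sub, map_sub, ← Module.End.mul_apply (N ^ k) N, ← pow_succ, hadj (k + 1), b2, mul_zero,
      sub_zero] at b1
    exact b1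
  have hB : ∀ w ∈ W ((n : ℤ) - k), Q u w = 0 := by
    intro w hw
    obtain ⟨v, hv, hvw⟩ := (hiso k).2 w hw
    have c1 := horth' k u hu _ hvw
    rw [map_sub, hA v hv, zero_sub, neg_eq_zero] at c1
    exact c1
  have hle : W ((n : ℤ) + k - 1) ≤ LinearMap.BilinForm.orthogonal Q (W ((n : ℤ) - k)) := by
    intro x hx
    rw [LinearMap.BilinForm.mem_orthogonal_iff]
    intro w hw
    cases k with
    | zero =>
      refine horth' 0 w (hmono (by simp) hw) x (hmono (by simp) hx)
    | succ j =>
      apply hz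
      exact horth' j x (hmono (by push_cast; omega) hx) w (hmono (by push_cast; omega) hw)
  have hnd : LinearMap.BilinForm.Nondegenerate Q :=
    ⟨hQnondeg, fun v hv => hQnondeg v fun w => hz _ _ (hv w)⟩
  have heq := Submodule.eq_of_le_of_finrank_le hle (by
    rw [LinearMap.BilinForm.finrank_orthogonal hnd]
    have := hdim (n + 1) k (by omega)
    omega)
  rw [heq, LinearMap.BilinForm.mem_orthogonal_iff]
  exact fun w hw => hz _ _ (hB w hw)
end

section
/- Let g be a finite-dimensional Lie algebra over a field of characteristic zero and let Y, N ∈ g satisfy [Y, N] = −2N. If M, M' ∈ g are such that both (M, Y, N) and (M', Y, N) are sl₂-triples, i.e. [Y,M] = 2M, [M,N] = Y and [Y,M'] = 2M', [M',N] = Y, then M = M'. -/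
/-- Uniqueness of the element `M` completing `(Y, N)` with `⁅Y, N⁆ = -2 • N` to an
`sl₂`-triple `(M, Y, N)` (i.e. `⁅Y, M⁆ = 2 • M` and `⁅M, N⁆ = Y`). -/
theorem sl2_triple_M_unique {K L : Type*} [Field K] [CharZero K]
    [LieRing L] [LieAlgebra K L] [FiniteDimensional K L]
    (Y N M M' : L)
    (hYN : ⁅Y, N⁆ = (-2 : K) • N)
    (hYM : ⁅Y, M⁆ = (2 : K) • M) (hMN : ⁅M, N⁆ = Y)
    (hYM' : ⁅Y, M'⁆ = (2 : K) • M') (hM'N : ⁅M', N⁆ = Y) :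
    M = M' := by
  have h2 : (2 : K) ≠ 0 := two_ne_zero
  by_cases hY : Y = 0
  · subst hY
    rw [zero_lie, eq_comm, smul_eq_zero_iff_right h2] at hYM hYM'
    rw [hYM, hYM']
  by_contra hne
  have t : IsSl2Triple Y M N :=
    { h_ne_zero := hY
      lie_e_f := hMN
      lie_h_e_nsmul := by rw [hYM, two_smul, two_nsmul]
      lie_h_f_nsmul := by rw [hYN, neg_smul, two_smul, two_nsmul] }
  have P : t.symm.HasPrimitiveVectorWith (M - M') (-2 : K) :=
    { ne_zero := sub_ne_zero.mpr hne
      lie_h := by rw [neg_lie, lie_sub, hYM, hYM', ← smul_sub, neg_smul]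
      lie_e := by rw [← lie_skew, sub_lie, hMN, hM'N, sub_self, neg_zero] }
  obtain ⟨n, hn⟩ := P.exists_nat
  have h : ((n + 2 : ℕ) : K) = 0 := by
    push_cast
    rw [← hn]
    ring
  exact absurd (Nat.cast_eq_zero.mp h) (by omega)
end

section
/- Let V_ℝ be a finite-dimensional real vector space with complexification V and conjugation v ↦ v̄. Let W be an increasing filtration of V by conjugation-stable subspaces and F a decreasing filtration of V. Then there is at most one bigrading V = ⊕_{p,q ∈ ℤ} I^{p,q} (finitely many nonzero summands) such that W_ℓ = ⊕_{p+q ≤ ℓ} I^{p,q} for all ℓ, F^a = ⊕_{p ≥ a} I^{p,q} for all a, and conj(I^{p,q}) ≡ I^{q,p} modulo ⊕_{r<q, s<p} I^{r,s} for all p,q. -/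
/-- A Deligne bigrading for a pair `(W, F)` on the complexification `V` of a real vector
space, relative to the conjugation `conj`: a direct sum decomposition `V = ⊕ I p q`
(finitely many nonzero summands) with `W ℓ = ⊕_{p+q ≤ ℓ} I p q`, `F a = ⊕_{p ≥ a} I p q`,
and `conj (I p q) ≡ I q p` modulo `⊕_{r < q, s < p} I r s`. -/
def IsDeligneBigrading {V : Type*} [AddCommGroup V] [Module ℂ V]
    (conj : V → V) (W F : ℤ → Submodule ℂ V) (I : ℤ → ℤ → Submodule ℂ V) : Prop :=
  {pq : ℤ × ℤ | I pq.1 pq.2 ≠ ⊥}.Finite ∧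
  DirectSum.IsInternal (fun pq : ℤ × ℤ => I pq.1 pq.2) ∧
  (∀ ℓ : ℤ, W ℓ = ⨆ (pq : ℤ × ℤ) (_ : pq.1 + pq.2 ≤ ℓ), I pq.1 pq.2) ∧
  (∀ a : ℤ, F a = ⨆ (pq : ℤ × ℤ) (_ : a ≤ pq.1), I pq.1 pq.2) ∧
  (∀ p q : ℤ, ∀ v ∈ I p q,
    conj v ∈ I q p ⊔ ⨆ (rs : ℤ × ℤ) (_ : rs.1 < q ∧ rs.2 < p), I rs.1 rs.2)

theorem dbu_mem_iff {V : Type*} [AddCommGroup V] [Module ℂ V] {ι : Type*} [DecidableEq ι]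
    (J : ι → Submodule ℂ V) [DirectSum.Decomposition J] (S : ι → Prop) (x : V) :
    x ∈ (⨆ (i : ι) (_ : S i), J i) ↔ ∀ i, ¬ S i → (DirectSum.decompose J x i : V) = 0 := by
  classical
  constructor
  · intro hx i hi
    have hle : (⨆ (i : ι) (_ : S i), J i) ≤ LinearMap.ker
        ((J i).subtype ∘ₗ DirectSum.component ℂ ι (fun i => J i) i ∘ₗ
          (DirectSum.decomposeLinearEquiv J).toLinearMap) := by
      refine iSup₂_le fun j hj y hy => ?_
      have hne : j ≠ i := fun h => hi (h ▸ hj)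
      have := DirectSum.decompose_of_mem_ne J hy hne
      exact this
    have := hle hx
    exact this
  · intro h
    rw [← DirectSum.sum_support_decompose J x]
    refine Submodule.sum_mem _ fun i hi => ?_
    by_cases hS : S i
    · exact (le_iSup₂_of_le (f := fun (i : ι) (_ : S i) => J i) i hS le_rfl)
        (DirectSum.decompose J x i).2
    · rw [h i hS]; exact zero_mem _

theorem dbu_inf_le {V : Type*} [AddCommGroup V] [Module ℂ V] {ι : Type*} [DecidableEq ι]
    (J : ι → Submodule ℂ V) (hJ : DirectSum.IsInternal J) (S T : ι → Prop) :
    (⨆ (i : ι) (_ : S i), J i) ⊓ (⨆ (i : ι) (_ : T i), J i)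
      ≤ ⨆ (i : ι) (_ : S i ∧ T i), J i := by
  classical
  letI := hJ.chooseDecomposition
  rintro x ⟨h1, h2⟩
  have h1' := (dbu_mem_iff J S x).1 h1
  have h2' := (dbu_mem_iff J T x).1 h2
  refine (dbu_mem_iff J _ x).2 fun i hi => ?_
  by_cases hS : S i
  · exact h2' i fun hT => hi ⟨hS, hT⟩
  · exact h1' i hS

theorem dbu_le {V : Type*} [AddCommGroup V] [Module ℂ V]
    (conj : V → V)
    (hconj_add : ∀ u v : V, conj (u + v) = conj u + conj v)
    (hconj_smul : ∀ (a : ℂ) (v : V), conj (a • v) = (starRingEnd ℂ a) • conj v)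
    (hconj_invol : ∀ v : V, conj (conj v) = v)
    (W F : ℤ → Submodule ℂ V)
    (I I' : ℤ → ℤ → Submodule ℂ V)
    (hI : IsDeligneBigrading conj W F I) (hI' : IsDeligneBigrading conj W F I') (p q : ℤ) :
    I p q ≤ I' p q := by
  obtain ⟨-, -, hW, hF, hc⟩ := hI
  obtain ⟨-, hd', hW', hF', hc'⟩ := hI'
  let c : V →ₛₗ[starRingEnd ℂ] V :=
    { toFun := conj, map_add' := hconj_add, map_smul' := hconj_smul }
  let U : Submodule ℂ V := (F q ⊓ W (p + q)) ⊔
    ⨆ (j : ℤ) (_ : 1 ≤ j), F (q - j) ⊓ W (p + q - j - 1)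
  have memF : ∀ a r s, a ≤ r → I r s ≤ F a := fun a r s h => by
    rw [hF]
    exact le_iSup₂_of_le (f := fun (i : ℤ × ℤ) (_ : a ≤ i.1) => I i.1 i.2) (r, s) h le_rfl
  have memW : ∀ a r s, r + s ≤ a → I r s ≤ W a := fun a r s h => by
    rw [hW]
    exact le_iSup₂_of_le (f := fun (i : ℤ × ℤ) (_ : i.1 + i.2 ≤ a) => I i.1 i.2) (r, s) h le_rfl
  have h1 : (I q p ⊔ ⨆ (rs : ℤ × ℤ) (_ : rs.1 < q ∧ rs.2 < p), I rs.1 rs.2) ≤ U := by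
    refine sup_le (le_sup_of_le_left (le_inf (memF _ _ _ le_rfl) (memW _ _ _ (by omega)))) ?_
    refine iSup₂_le fun rs h => le_sup_of_le_right ?_
    refine le_iSup₂_of_le (q - rs.1) (by omega) (le_inf (memF _ _ _ (by omega))
      (memW _ _ _ (by omega)))
  let N : Submodule ℂ V := ⨆ (i : ℤ × ℤ) (_ : i = (p, q) ∨ i.1 < p), I' i.1 i.2
  have memN : ∀ r s, ((r, s) = (p, q) ∨ r < p) → I' r s ≤ N := fun r s h =>
    le_iSup₂_of_le (f := fun (i : ℤ × ℤ) (_ : i = (p, q) ∨ i.1 < p) => I' i.1 i.2) (r, s) h le_rfl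
  have key : ∀ r s, ((r = q ∧ s = p) ∨ s < p) → I' r s ≤ N.comap c := by
    intro r s h v hv
    have h3 := hc' r s v hv
    refine (sup_le (memN _ _ ?_) (iSup₂_le fun i hi => memN _ _ ?_) :
      _ ≤ N) h3
    · rcases h with ⟨rfl, rfl⟩ | h
      · exact Or.inl rfl
      · exact Or.inr h
    · right
      omega
  have h2 : U ≤ N.comap c := by
    have aux : ∀ a l, (∀ r s, a ≤ r → r + s ≤ l → (r = q ∧ s = p) ∨ s < p) →
        F a ⊓ W l ≤ N.comap c := by
      intro a l h
      rw [hF', hW']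
      refine (dbu_inf_le (fun i : ℤ × ℤ => I' i.1 i.2) hd' _ _).trans ?_
      exact iSup₂_le fun i hi => key _ _ (h _ _ hi.1 hi.2)
    refine sup_le (aux _ _ fun r s _ _ => by omega) (iSup₂_le fun j hj =>
      aux _ _ fun r s _ _ => by omega)
  intro v hv
  have hvN : v ∈ N := by
    have := h2 (h1 (hc p q v hv))
    have h4 : conj (conj v) ∈ N := this
    rwa [hconj_invol] at h4
  have hvF : v ∈ F p := memF _ _ _ le_rfl hv
  rw [hF'] at hvF
  have h5 := dbu_inf_le (fun i : ℤ × ℤ => I' i.1 i.2) hd' _ _ ⟨hvN, hvF⟩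
  refine (iSup₂_le fun i hi => ?_ : _ ≤ I' p q) h5
  rcases hi with ⟨rfl | h, h'⟩
  · exact le_rfl
  · omega

/-- Uniqueness of the Deligne bigrading associated to a pair `(W, F)`, where `W` is an
increasing filtration by conjugation-stable subspaces and `F` is a decreasing filtration. -/
theorem deligne_bigrading_unique {V : Type*} [AddCommGroup V] [Module ℂ V]
    [FiniteDimensional ℂ V]
    (conj : V → V)
    (hconj_add : ∀ u v : V, conj (u + v) = conj u + conj v)
    (hconj_smul : ∀ (a : ℂ) (v : V), conj (a • v) = (starRingEnd ℂ a) • conj v)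
    (hconj_invol : ∀ v : V, conj (conj v) = v)
    (W F : ℤ → Submodule ℂ V)
    (hWmono : Monotone W)
    (hWconj : ∀ ℓ : ℤ, ∀ v ∈ W ℓ, conj v ∈ W ℓ)
    (hFanti : Antitone F)
    (I I' : ℤ → ℤ → Submodule ℂ V)
    (hI : IsDeligneBigrading conj W F I) (hI' : IsDeligneBigrading conj W F I') :
    ∀ p q : ℤ, I p q = I' p q := by
  intro p q
  exact le_antisymm
    (dbu_le conj hconj_add hconj_smul hconj_invol W F I I' hI hI' p q)
    (dbu_le conj hconj_add hconj_smul hconj_invol W F I' I hI' hI p q)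
end

section
/- Let V_ℝ be a finite-dimensional real vector space with complexification V and conjugation v ↦ v̄, W an increasing filtration of V by conjugation-stable subspaces (exhaustive and separated), and F a decreasing filtration of V (exhaustive and separated). Assume (W, F) is a mixed Hodge structure: for every ℓ, the filtration induced by F on Gr_ℓ = W_ℓ/W_{ℓ−1} defines a pure Hodge structure of weight ℓ, i.e. Gr_ℓ = F^p Gr_ℓ ⊕ conj(F^{ℓ+1−p} Gr_ℓ) for every p. Then there exists a Deligne bigrading for (W, F): a decomposition V = ⊕_{p,q} I^{p,q} with W_ℓ = ⊕_{p+q ≤ ℓ} I^{p,q}, F^a = ⊕_{p ≥ a} I^{p,q}, and conj(I^{p,q}) ≡ I^{q,p} modulo ⊕_{r<q, s<p} I^{r,s}. -/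
namespace DelB

variable {V : Type*} [AddCommGroup V] [Module ℂ V]

structure MH (W F G : ℤ → Submodule ℂ V) : Prop where
  Wm : Monotone W
  Fa : Antitone F
  Ga : Antitone G
  Wb : ∃ a : ℤ, ∀ l ≤ a, W l = ⊥
  ex : ∀ l p : ℤ, ∀ w ∈ W l, ∃ u ∈ F p ⊓ W l, ∃ v ∈ G (l + 1 - p) ⊓ W l, w - u - v ∈ W (l - 1)
  un : ∀ l p : ℤ, ∀ u ∈ F p ⊓ W l, ∀ v ∈ G (l + 1 - p) ⊓ W l, u - v ∈ W (l - 1) → u ∈ W (l - 1)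

def I (W F G : ℤ → Submodule ℂ V) (p q : ℤ) : Submodule ℂ V :=
  (F p ⊓ W (p + q)) ⊓ ⨅ k : ℕ, (G (q - k) ⊔ W (p + q - k - 2))

theorem mem_I {W F G : ℤ → Submodule ℂ V} {p q : ℤ} {x : V} :
    x ∈ I W F G p q ↔ (x ∈ F p ∧ x ∈ W (p + q)) ∧
      ∀ k : ℕ, x ∈ G (q - k) ⊔ W (p + q - k - 2) := by
  simp [I, Submodule.mem_iInf]

variable {W F G : ℤ → Submodule ℂ V}

theorem MH.sep (h : MH W F G) {n a b : ℤ} {x : V} (hx : x ∈ W n)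
    (h1 : x ∈ F a ⊔ W (n - 1)) (h2 : x ∈ G b ⊔ W (n - 1)) (hab : n + 1 ≤ a + b) :
    x ∈ W (n - 1) := by
  obtain ⟨f, hf, w, hw, e⟩ := Submodule.mem_sup.1 h1
  obtain ⟨g, hg, w', hw', e'⟩ := Submodule.mem_sup.1 h2
  have hle : W (n - 1) ≤ W n := h.Wm (by omega)
  have hfW : f ∈ W n := by
    have : f = x - w := by rw [← e]; abel
    rw [this]; exact sub_mem hx (hle hw)
  have hgW : g ∈ W n := by
    have : g = x - w' := by rw [← e']; abel
    rw [this]; exact sub_mem hx (hle hw')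
  have := h.un n a f ⟨hf, hfW⟩ g ⟨h.Ga (by omega) hg, hgW⟩ (by
    have : f - g = w' - w := by
      have := e.trans e'.symm
      rw [sub_eq_sub_iff_add_eq_add, this, add_comm]
    rw [this]; exact sub_mem hw' hw)
  rw [← e]; exact add_mem this hw

theorem MH.zero (h : MH W F G) {x : V} {n : ℤ} (hx : ∀ k : ℕ, x ∈ W (n - k)) : x = 0 := by
  obtain ⟨a, ha⟩ := h.Wb
  have := hx (n - a).toNat
  rw [ha _ (by omega)] at this
  simpa using this

theorem MH.inj (h : MH W F G) {p q : ℤ} {x : V} (hx : x ∈ I W F G p q)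
    (hW : x ∈ W (p + q - 1)) : x = 0 := by
  rw [mem_I] at hx
  obtain ⟨⟨hF, -⟩, hk⟩ := hx
  apply h.zero (n := p + q - 1)
  intro k
  induction k with
  | zero => simpa using hW
  | succ k ih =>
    have := h.sep (a := p) (b := q - k) ih (Submodule.mem_sup_left hF)
      (by convert hk k using 3; ring) (by omega)
    convert this using 2; push_cast; ring

theorem MH.lift (h : MH W F G) {p q l : ℤ} (hl : p + q = l) {z : V} (hz : z ∈ W l)
    (h1 : z ∈ F p ⊔ W (l - 1)) (h2 : z ∈ G q ⊔ W (l - 1)) :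
    ∃ x ∈ I W F G p q, z - x ∈ W (l - 1) := by
  subst hl
  obtain ⟨f, hf, w, hw, e⟩ := Submodule.mem_sup.1 h1
  have hle : W (p + q - 1) ≤ W (p + q) := h.Wm (by omega)
  have key : ∀ k : ℕ, ∃ x, x ∈ F p ∧ z - x ∈ W (p + q - 1) ∧
      (∀ m : ℕ, m < k → x ∈ G (q - m) ⊔ W (p + q - m - 2)) ∧
      x ∈ G (q - k + 1) ⊔ G q ⊔ W (p + q - k - 1) := by
    intro k
    induction k with
    | zero =>
      refine ⟨f, hf, by rw [← e]; simpa using hw, by simp, ?_⟩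
      have : f = z - w := by rw [← e]; abel
      rw [this]
      have hle2 : G q ⊔ W (p + q - 1) ≤ G (q - (0:ℕ) + 1) ⊔ G q ⊔ W (p + q - (0:ℕ) - 1) := by
        simp only [Nat.cast_zero, sub_zero]
        exact sup_le_sup_right le_sup_right _
      exact hle2 (sub_mem h2 (Submodule.mem_sup_right hw))
    | succ k ih =>
      obtain ⟨x, hxF, hxz, hxm, hxk⟩ := ih
      obtain ⟨y, hy, w, hw, e⟩ := Submodule.mem_sup.1 hxk
      have hy' : y ∈ G (q - k) := (sup_le (h.Ga (by omega)) (h.Ga (by omega)) :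
        G (q - k + 1) ⊔ G q ≤ G (q - k)) hy
      obtain ⟨a, ⟨haF, haW⟩, b, ⟨hbG, hbW⟩, hab⟩ := h.ex _ p w hw
      have hxa : x - a ∈ G (q - k) ⊔ W (p + q - k - 2) := by
        have : x - a = (y + b) + (w - a - b) := by rw [← e]; abel
        rw [this]
        refine Submodule.add_mem_sup (add_mem hy' ?_) ?_
        · exact h.Ga (by omega) hbG
        · convert hab using 2; ring
      refine ⟨x - a, sub_mem hxF haF, ?_, ?_, ?_⟩
      · have : z - (x - a) = (z - x) + a := by abel
        rw [this]
        exact add_mem hxz (h.Wm (by omega) haW)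
      · intro m hm
        rcases Nat.lt_succ_iff_lt_or_eq.1 hm with hm | rfl
        · exact sub_mem (hxm m hm) (Submodule.mem_sup_right (h.Wm (by omega) haW))
        · exact hxa
      · refine (sup_le_sup ((h.Ga ?_).trans le_sup_left) (h.Wm ?_) :
          G (q - k) ⊔ W (p + q - k - 2) ≤ _) hxa <;> push_cast <;> omega
  obtain ⟨c, hc⟩ := h.Wb
  obtain ⟨x, hxF, hxz, hxm, hxk⟩ := key (p + q - c).toNat
  refine ⟨x, mem_I.2 ⟨⟨hxF, ?_⟩, fun m => ?_⟩, hxz⟩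
  · have : x = z - (z - x) := by abel
    rw [this]; exact sub_mem hz (hle hxz)
  · by_cases hm : m < (p + q - c).toNat
    · exact hxm m hm
    · rw [hc (p + q - ↑(p + q - c).toNat - 1) (by omega), sup_bot_eq] at hxk
      exact Submodule.mem_sup_left ((sup_le (h.Ga (by omega)) (h.Ga (by omega)) :
        G (q - ((p + q - c).toNat : ℤ) + 1) ⊔ G q ≤ G (q - m)) hxk)

theorem MH.decomp (h : MH W F G) (n b : ℤ) (k : ℕ) : ∀ (a : ℤ) (z : V), n + 1 - a - b ≤ k →
    z ∈ W n → z ∈ F a ⊔ W (n - 1) → z ∈ G b ⊔ W (n - 1) →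
    ∃ y ∈ ⨆ (rs : ℤ × ℤ) (_ : rs.1 + rs.2 = n ∧ a ≤ rs.1 ∧ b ≤ rs.2), I W F G rs.1 rs.2,
      z - y ∈ W (n - 1) := by
  induction k with
  | zero =>
    intro a z hk hz h1 h2
    exact ⟨0, zero_mem _, by simpa using h.sep hz h1 h2 (by push_cast at hk; omega)⟩
  | succ k ih =>
    intro a z hk hz h1 h2
    by_cases hab : n + 1 ≤ a + b
    · exact ⟨0, zero_mem _, by simpa using h.sep hz h1 h2 hab⟩
    obtain ⟨u, ⟨huF, huW⟩, v, ⟨hvG, hvW⟩, huv⟩ := h.ex n (a + 1) z hz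
    have hvG' : v ∈ G (n - a) := h.Ga (by omega) hvG
    have hu : u ∈ G b ⊔ W (n - 1) := by
      have : u = z - v - (z - u - v) := by abel
      rw [this]
      exact sub_mem (sub_mem h2 (Submodule.mem_sup_left (h.Ga (by omega) hvG')))
        (Submodule.mem_sup_right huv)
    have hv : v ∈ F a ⊔ W (n - 1) := by
      have : v = z - u - (z - u - v) := by abel
      rw [this]
      exact sub_mem (sub_mem h1 (Submodule.mem_sup_left (h.Fa (by omega) huF)))
        (Submodule.mem_sup_right huv)
    obtain ⟨x, hx, hvx⟩ := h.lift (p := a) (q := n - a) (by ring) hvW hv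
      (Submodule.mem_sup_left hvG')
    obtain ⟨y, hy, huy⟩ := ih (a + 1) u (by push_cast at hk; omega) huW
      (Submodule.mem_sup_left huF) hu
    refine ⟨x + y, add_mem ?_ ?_, ?_⟩
    · exact Submodule.mem_iSup_of_mem (a, n - a)
        (Submodule.mem_iSup_of_mem ⟨by simp, by simp, by simp; omega⟩ hx)
    · exact (iSup₂_le fun rs hrs => le_iSup₂_of_le rs ⟨hrs.1, by omega, hrs.2.2⟩ le_rfl :
        (⨆ (rs : ℤ × ℤ) (_ : rs.1 + rs.2 = n ∧ a + 1 ≤ rs.1 ∧ b ≤ rs.2), I W F G rs.1 rs.2)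
          ≤ _) hy
    · have : z - (x + y) = (v - x) + (u - y) + (z - u - v) := by abel
      rw [this]
      exact add_mem (add_mem hvx huy) huv

theorem MH.span (h : MH W F G) (hG : ∃ b, G b = ⊤) (a : ℤ) (n : ℤ) (x : V)
    (hF : x ∈ F a) (hW : x ∈ W n) :
    x ∈ ⨆ (pq : ℤ × ℤ) (_ : a ≤ pq.1 ∧ pq.1 + pq.2 ≤ n), I W F G pq.1 pq.2 := by
  obtain ⟨c, hc⟩ := h.Wb
  obtain ⟨b, hb⟩ := hG
  have key : ∀ k : ℕ, ∀ n x, n - c ≤ k → x ∈ F a → x ∈ W n →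
      x ∈ ⨆ (pq : ℤ × ℤ) (_ : a ≤ pq.1 ∧ pq.1 + pq.2 ≤ n), I W F G pq.1 pq.2 := by
    intro k
    induction k with
    | zero =>
      intro n x hn _ hW
      rw [hc n (by push_cast at hn; omega)] at hW
      rw [(Submodule.mem_bot ℂ).1 hW]; exact zero_mem _
    | succ k ih =>
      intro n x hn hF hW
      obtain ⟨y, hy, hxy⟩ := h.decomp n b (n + 1 - a - b).toNat a x (by omega) hW
        (Submodule.mem_sup_left hF) (by rw [hb]; simp)
      have hyF : y ∈ F a := (iSup₂_le fun rs hrs => fun t ht =>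
        h.Fa hrs.2.1 (mem_I.1 ht).1.1 : (⨆ (rs : ℤ × ℤ)
          (_ : rs.1 + rs.2 = n ∧ a ≤ rs.1 ∧ b ≤ rs.2), I W F G rs.1 rs.2) ≤ F a) hy
      have h3 := ih (n - 1) (x - y) (by push_cast at hn; omega) (sub_mem hF hyF) hxy
      have : x = y + (x - y) := by abel
      rw [this]
      refine add_mem ?_ ?_
      · exact (iSup₂_le fun rs hrs => le_iSup₂_of_le rs ⟨hrs.2.1, by omega⟩ le_rfl :
          (⨆ (rs : ℤ × ℤ) (_ : rs.1 + rs.2 = n ∧ a ≤ rs.1 ∧ b ≤ rs.2), I W F G rs.1 rs.2)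
            ≤ _) hy
      · exact (iSup₂_le fun rs hrs => le_iSup₂_of_le rs ⟨hrs.1, by omega⟩ le_rfl :
          (⨆ (rs : ℤ × ℤ) (_ : a ≤ rs.1 ∧ rs.1 + rs.2 ≤ n - 1), I W F G rs.1 rs.2)
            ≤ _) h3
  exact key (n - c).toNat n x (by omega) hF hW

theorem MH.cong (h : MH W F G) (p q : ℤ) (z : V) (hz : z ∈ W (p + q - 1))
    (h1 : ∀ k : ℕ, z ∈ F (q - k) ⊔ W (p + q - k - 2))
    (h2 : ∀ k : ℕ, z ∈ G (p - k) ⊔ W (p + q - k - 2)) :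
    z ∈ ⨆ (rs : ℤ × ℤ) (_ : rs.1 < q ∧ rs.2 < p), I W F G rs.1 rs.2 := by
  obtain ⟨c, hc⟩ := h.Wb
  have key : ∀ j k : ℕ, ∀ z, p + q - k - 1 - c ≤ j → z ∈ W (p + q - k - 1) →
      (∀ m : ℕ, k ≤ m → z ∈ F (q - m) ⊔ W (p + q - m - 2)) →
      (∀ m : ℕ, k ≤ m → z ∈ G (p - m) ⊔ W (p + q - m - 2)) →
      z ∈ ⨆ (rs : ℤ × ℤ) (_ : rs.1 < q ∧ rs.2 < p), I W F G rs.1 rs.2 := by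
    intro j
    induction j with
    | zero =>
      intro k z hn hW _ _
      rw [hc _ (by push_cast at hn; omega)] at hW
      rw [(Submodule.mem_bot ℂ).1 hW]; exact zero_mem _
    | succ j ih =>
      intro k z hn hW h1 h2
      have e : p + q - k - 1 - 1 = p + q - k - 2 := by ring
      obtain ⟨y, hy, hxy⟩ := h.decomp (p + q - k - 1) (p - k)
        ((p + q - k - 1) + 1 - (q - k) - (p - k)).toNat (q - k) z (by omega) hW
        (by rw [e]; exact h1 k le_rfl) (by rw [e]; exact h2 k le_rfl)
      have hyF : ∀ m : ℕ, k + 1 ≤ m → y ∈ F (q - m) ⊔ W (p + q - m - 2) := fun m hm =>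
        (iSup₂_le fun rs hrs => fun t ht => Submodule.mem_sup_left
          (h.Fa (by omega) (mem_I.1 ht).1.1) : (⨆ (rs : ℤ × ℤ)
          (_ : rs.1 + rs.2 = p + q - k - 1 ∧ q - k ≤ rs.1 ∧ p - k ≤ rs.2),
            I W F G rs.1 rs.2) ≤ F (q - m) ⊔ W (p + q - m - 2)) hy
      have hyG : ∀ m : ℕ, k + 1 ≤ m → y ∈ G (p - m) ⊔ W (p + q - m - 2) := fun m hm =>
        (iSup₂_le fun rs hrs => fun t ht =>
          (sup_le_sup (h.Ga (by omega)) (h.Wm (by omega)) :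
            G (rs.2 - (m - k - 1 : ℕ)) ⊔ W (rs.1 + rs.2 - (m - k - 1 : ℕ) - 2) ≤ _)
            ((mem_I.1 ht).2 (m - k - 1)) : (⨆ (rs : ℤ × ℤ)
          (_ : rs.1 + rs.2 = p + q - k - 1 ∧ q - k ≤ rs.1 ∧ p - k ≤ rs.2),
            I W F G rs.1 rs.2) ≤ G (p - m) ⊔ W (p + q - m - 2)) hy
      have h3 := ih (k + 1) (z - y) (by push_cast at hn ⊢; omega)
        (by convert hxy using 2; push_cast; ring)
        (fun m hm => sub_mem (h1 m (by omega)) (hyF m hm))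
        (fun m hm => sub_mem (h2 m (by omega)) (hyG m hm))
      have : z = y + (z - y) := by abel
      rw [this]
      refine add_mem ?_ h3
      exact (iSup₂_le fun rs hrs => le_iSup₂_of_le rs ⟨by omega, by omega⟩ le_rfl :
          (⨆ (rs : ℤ × ℤ) (_ : rs.1 + rs.2 = p + q - k - 1 ∧ q - k ≤ rs.1 ∧ p - k ≤ rs.2),
            I W F G rs.1 rs.2) ≤ _) hy
  exact key (p + q - 1 - c).toNat 0 z (by push_cast; omega) (by simpa using hz)
    (fun m _ => h1 m) (fun m _ => h2 m)

theorem MH.indep (h : MH W F G) (s : Finset (ℤ × ℤ)) (x : ℤ × ℤ → V)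
    (hx : ∀ i, x i ∈ I W F G i.1 i.2) (hs : ∑ i ∈ s, x i = 0) : ∀ i ∈ s, x i = 0 := by
  classical
  induction s using Finset.strongInduction with
  | H s ih =>
  rcases s.eq_empty_or_nonempty with rfl | hne
  · simp
  obtain ⟨i, hi, hmax⟩ := Finset.exists_max_image s
    (fun i : ℤ × ℤ => toLex (i.1 + i.2, -i.1)) hne
  have hsum := Finset.add_sum_erase s x hi
  rw [hs] at hsum
  have hrest : ∑ j ∈ s.erase i, x j ∈ F (i.1 + 1) ⊔ W (i.1 + i.2 - 1) := by
    refine Submodule.sum_mem _ fun j hj => ?_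
    obtain ⟨hji, hjs⟩ := Finset.mem_erase.1 hj
    have := hmax j hjs
    rw [Prod.Lex.toLex_le_toLex] at this
    simp only at this
    rcases this with h' | ⟨h1, h2⟩
    · exact Submodule.mem_sup_right (h.Wm (by omega) (mem_I.1 (hx j)).1.2)
    · have : j.1 ≠ i.1 := fun e => hji (Prod.ext e (by omega))
      exact Submodule.mem_sup_left (h.Fa (by omega) (mem_I.1 (hx j)).1.1)
  have hxi : x i = 0 := by
    apply h.inj (hx i)
    refine h.sep (a := i.1 + 1) (b := i.2) (mem_I.1 (hx i)).1.2 ?_ ?_ (by omega)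
    · rw [eq_neg_of_add_eq_zero_left hsum]; exact neg_mem hrest
    · have := (mem_I.1 (hx i)).2 0
      refine (sup_le_sup (h.Ga (by simp)) (h.Wm (by simp)) :
        G (i.2 - (0:ℕ)) ⊔ W (i.1 + i.2 - (0:ℕ) - 2) ≤ _) this
  have h3 := ih (s.erase i) (Finset.erase_ssubset hi) (by simpa [hxi] using hsum)
  intro j hj
  by_cases e : j = i
  · rw [e, hxi]
  · exact h3 j (Finset.mem_erase.2 ⟨e, hj⟩)

theorem MH.internal (h : MH W F G) (htop : ⨆ pq : ℤ × ℤ, I W F G pq.1 pq.2 = ⊤) :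
    DirectSum.IsInternal (fun pq : ℤ × ℤ => I W F G pq.1 pq.2) := by
  classical
  rw [DirectSum.isInternal_submodule_iff_iSupIndep_and_iSup_eq_top]
  refine ⟨?_, htop⟩
  apply iSupIndep_of_dfinsupp_lsum_injective
  rw [← LinearMap.ker_eq_bot, LinearMap.ker_eq_bot']
  intro m hm
  rw [DFinsupp.lsum_apply_apply, DFinsupp.sumAddHom_apply, DFinsupp.sum] at hm
  have := h.indep m.support (fun i => (m i : V)) (fun i => (m i).2) (by simpa using hm)
  ext i
  by_cases hi : i ∈ m.support
  · simpa using this i hi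
  · simpa using hi

end DelB

/-- Existence of the Deligne bigrading of a mixed Hodge structure `(W, F)`.  The mixed
Hodge structure condition says that on each graded quotient `Gr ℓ = W ℓ / W (ℓ-1)` the
filtration induced by `F` defines a pure Hodge structure of weight `ℓ`:
`Gr ℓ = F^p Gr ℓ ⊕ conj (F^(ℓ+1-p) Gr ℓ)` for every `p`, expressed via representatives. -/
theorem deligne_bigrading_exists {V : Type*} [AddCommGroup V] [Module ℂ V]
    [FiniteDimensional ℂ V]
    (conj : V → V)
    (hconj_add : ∀ u v : V, conj (u + v) = conj u + conj v)
    (hconj_smul : ∀ (a : ℂ) (v : V), conj (a • v) = (starRingEnd ℂ a) • conj v)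
    (hconj_invol : ∀ v : V, conj (conj v) = v)
    (W F : ℤ → Submodule ℂ V)
    (hWmono : Monotone W)
    (hWbot : ∃ a : ℤ, ∀ ℓ : ℤ, ℓ ≤ a → W ℓ = ⊥)
    (hWtop : ∃ b : ℤ, ∀ ℓ : ℤ, b ≤ ℓ → W ℓ = ⊤)
    (hWconj : ∀ ℓ : ℤ, ∀ v ∈ W ℓ, conj v ∈ W ℓ)
    (hFanti : Antitone F)
    (hFtop : ∃ a : ℤ, ∀ p : ℤ, p ≤ a → F p = ⊤)
    (hFbot : ∃ b : ℤ, ∀ p : ℤ, b ≤ p → F p = ⊥)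
    (hMHS : ∀ ℓ p : ℤ,
      (∀ w ∈ W ℓ, ∃ u ∈ F p ⊓ W ℓ, ∃ v ∈ F (ℓ + 1 - p) ⊓ W ℓ,
        w - u - conj v ∈ W (ℓ - 1)) ∧
      (∀ u ∈ F p ⊓ W ℓ, ∀ v ∈ F (ℓ + 1 - p) ⊓ W ℓ,
        u - conj v ∈ W (ℓ - 1) → u ∈ W (ℓ - 1))) :
    ∃ I : ℤ → ℤ → Submodule ℂ V, IsDeligneBigrading conj W F I := by
  classical
  have hconj_zero : conj 0 = 0 := by simpa using hconj_smul 0 0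
  have hconj_neg : ∀ v, conj (-v) = - conj v := fun v => by
    have := hconj_smul (-1) v
    simpa using this
  have hconj_sub : ∀ u v, conj (u - v) = conj u - conj v := fun u v => by
    rw [sub_eq_add_neg, hconj_add, hconj_neg, ← sub_eq_add_neg]
  let G : ℤ → Submodule ℂ V := fun p =>
    { carrier := {v | conj v ∈ F p}
      add_mem' := fun {a b} ha hb => by
        simp only [Set.mem_ofPred_eq] at *
        rw [hconj_add]; exact add_mem ha hb
      zero_mem' := by simp [hconj_zero]
      smul_mem' := fun c x hx => by
        simp only [Set.mem_ofPred_eq] at *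
        rw [hconj_smul]; exact Submodule.smul_mem _ _ hx }
  have hG : ∀ p v, v ∈ G p ↔ conj v ∈ F p := fun p v => Iff.rfl
  have hGF : ∀ p n v, v ∈ G p ⊔ W n → conj v ∈ F p ⊔ W n := by
    intro p n v hv
    obtain ⟨g, hg, w, hw, rfl⟩ := Submodule.mem_sup.1 hv
    rw [hconj_add]
    exact Submodule.add_mem_sup hg (hWconj _ _ hw)
  have h : DelB.MH W F G := by
    refine ⟨hWmono, hFanti, fun a b hab v hv => hFanti hab hv, hWbot, ?_, ?_⟩
    · intro l p w hw
      obtain ⟨u, hu, v, hv, e⟩ := (hMHS l p).1 w hw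
      exact ⟨u, hu, conj v, ⟨(hG _ _).2 (by rw [hconj_invol]; exact hv.1), hWconj _ _ hv.2⟩, e⟩
    · intro l p u hu v hv e
      exact (hMHS l p).2 u hu (conj v) ⟨hv.1, hWconj _ _ hv.2⟩ (by rwa [hconj_invol])
  obtain ⟨a0, ha0⟩ := hFtop
  obtain ⟨b0, hb0⟩ := hWtop
  have hGtop : ∃ b, G b = ⊤ := ⟨a0, by
    rw [eq_top_iff]; intro v _; rw [hG, ha0 a0 le_rfl]; trivial⟩
  have hint : DirectSum.IsInternal (fun pq : ℤ × ℤ => DelB.I W F G pq.1 pq.2) := by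
    apply h.internal
    rw [eq_top_iff]
    intro v _
    have := h.span hGtop a0 b0 v (by rw [ha0 a0 le_rfl]; trivial) (by rw [hb0 b0 le_rfl]; trivial)
    exact (iSup₂_le fun rs _ => le_iSup (fun pq : ℤ × ℤ => DelB.I W F G pq.1 pq.2) rs :
      (⨆ (pq : ℤ × ℤ) (_ : a0 ≤ pq.1 ∧ pq.1 + pq.2 ≤ b0), DelB.I W F G pq.1 pq.2) ≤ _) this
  refine ⟨DelB.I W F G, ?_, hint, ?_, ?_, ?_⟩
  · exact WellFoundedGT.finite_ne_bot_of_iSupIndep hint.submodule_iSupIndep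
  · intro l
    apply le_antisymm
    · intro v hv
      have := h.span hGtop a0 l v (by rw [ha0 a0 le_rfl]; trivial) hv
      exact (iSup₂_le fun rs hrs => le_iSup₂_of_le rs hrs.2 le_rfl :
        (⨆ (pq : ℤ × ℤ) (_ : a0 ≤ pq.1 ∧ pq.1 + pq.2 ≤ l), DelB.I W F G pq.1 pq.2) ≤ _) this
    · exact iSup₂_le fun rs hrs t ht => hWmono hrs (DelB.mem_I.1 ht).1.2
  · intro a
    apply le_antisymm
    · intro v hv
      have := h.span hGtop a b0 v hv (by rw [hb0 b0 le_rfl]; trivial)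
      exact (iSup₂_le fun rs hrs => le_iSup₂_of_le rs hrs.1 le_rfl :
        (⨆ (pq : ℤ × ℤ) (_ : a ≤ pq.1 ∧ pq.1 + pq.2 ≤ b0), DelB.I W F G pq.1 pq.2) ≤ _) this
    · exact iSup₂_le fun rs hrs t ht => hFanti hrs (DelB.mem_I.1 ht).1.1
  · intro p q v hv
    obtain ⟨⟨hvF, hvW⟩, hvk⟩ := DelB.mem_I.1 hv
    have hcG : conj v ∈ G p := by rw [hG, hconj_invol]; exact hvF
    have hcW := hWconj _ _ hvW
    have hcF : ∀ k : ℕ, conj v ∈ F (q - k) ⊔ W (p + q - k - 2) := fun k => hGF _ _ _ (hvk k)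
    have hcF0 : conj v ∈ F q ⊔ W (p + q - 1) := by
      refine (sup_le_sup (hFanti (by simp)) (hWmono (by simp)) :
        F (q - (0:ℕ)) ⊔ W (p + q - (0:ℕ) - 2) ≤ _) (hcF 0)
    obtain ⟨x, hx, hxz⟩ := h.lift (p := q) (q := p) (add_comm q p) hcW hcF0
      (Submodule.mem_sup_left hcG)
    obtain ⟨⟨hxF, hxW⟩, hxk⟩ := DelB.mem_I.1 hx
    have hc := h.cong p q (conj v - x) hxz
      (fun k => sub_mem (hcF k) (Submodule.mem_sup_left (hFanti (by omega) hxF)))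
      (fun k => sub_mem (Submodule.mem_sup_left (h.Ga (by omega) hcG))
        (by rw [add_comm p q]; exact hxk k))
    have e : conj v = x + (conj v - x) := by abel
    rw [e]
    exact Submodule.add_mem_sup hx hc
end

section
/- Let V_ℝ be a finite-dimensional real vector space with complexification V, and let (W, F) be a mixed Hodge structure on V_ℝ (W an increasing conjugation-stable filtration, F a decreasing filtration of V, inducing a pure Hodge structure of weight ℓ on each Gr_ℓ = W_ℓ/W_{ℓ−1}). Let g be the ℂ-linear extension of a real linear automorphism of V_ℝ such that g(W_ℓ) = W_ℓ and g(F^p) = F^p for all ℓ, p, and such that g induces the identity map on every graded quotient Gr_ℓ, i.e. (g − id)(W_ℓ) ⊆ W_{ℓ−1} for all ℓ. Then g = id. -/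
/-- An automorphism of a mixed Hodge structure `(W, F)` (defined over the reals, i.e.
commuting with the conjugation) that induces the identity on every graded quotient
`Gr ℓ = W ℓ / W (ℓ-1)` is the identity. -/
theorem mhs_automorphism_trivial_on_graded_is_id {V : Type*} [AddCommGroup V] [Module ℂ V]
    [FiniteDimensional ℂ V]
    (conj : V → V)
    (hconj_add : ∀ u v : V, conj (u + v) = conj u + conj v)
    (hconj_smul : ∀ (a : ℂ) (v : V), conj (a • v) = (starRingEnd ℂ a) • conj v)
    (hconj_invol : ∀ v : V, conj (conj v) = v)
    (W F : ℤ → Submodule ℂ V)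
    (hWmono : Monotone W)
    (hWbot : ∃ a : ℤ, ∀ ℓ : ℤ, ℓ ≤ a → W ℓ = ⊥)
    (hWtop : ∃ b : ℤ, ∀ ℓ : ℤ, b ≤ ℓ → W ℓ = ⊤)
    (hWconj : ∀ ℓ : ℤ, ∀ v ∈ W ℓ, conj v ∈ W ℓ)
    (hFanti : Antitone F)
    (hFtop : ∃ a : ℤ, ∀ p : ℤ, p ≤ a → F p = ⊤)
    (hFbot : ∃ b : ℤ, ∀ p : ℤ, b ≤ p → F p = ⊥)
    (hMHS : ∀ ℓ p : ℤ,
      (∀ w ∈ W ℓ, ∃ u ∈ F p ⊓ W ℓ, ∃ v ∈ F (ℓ + 1 - p) ⊓ W ℓ,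
        w - u - conj v ∈ W (ℓ - 1)) ∧
      (∀ u ∈ F p ⊓ W ℓ, ∀ v ∈ F (ℓ + 1 - p) ⊓ W ℓ,
        u - conj v ∈ W (ℓ - 1) → u ∈ W (ℓ - 1)))
    (g : V ≃ₗ[ℂ] V)
    (hg_conj : ∀ v : V, g (conj v) = conj (g v))
    (hgW : ∀ ℓ : ℤ, Submodule.map (g : V →ₗ[ℂ] V) (W ℓ) = W ℓ)
    (hgF : ∀ p : ℤ, Submodule.map (g : V →ₗ[ℂ] V) (F p) = F p)
    (hgGr : ∀ ℓ : ℤ, ∀ v ∈ W ℓ, g v - v ∈ W (ℓ - 1)) :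
    g = LinearEquiv.refl ℂ V := by
  have hNF : ∀ p : ℤ, ∀ v ∈ F p, g v - v ∈ F p := by
    intro p v hv
    refine (F p).sub_mem ?_ hv
    rw [← hgF p]
    exact Submodule.mem_map_of_mem (f := (g : V →ₗ[ℂ] V)) hv
  have hconj_neg : ∀ v : V, conj (-v) = - conj v := by
    intro v
    have h := hconj_smul (-1) v
    simpa using h
  have hconj_sub : ∀ u v : V, conj (u - v) = conj u - conj v := by
    intro u v
    rw [sub_eq_add_neg, hconj_add, hconj_neg, ← sub_eq_add_neg]
  have key : ∀ k : ℕ, ∀ ℓ : ℤ, ∀ v ∈ W ℓ, g v - v ∈ W (ℓ - ((k : ℤ) + 1)) := by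
    intro k
    induction k with
    | zero => simpa using hgGr
    | succ k ih =>
      intro ℓ
      obtain ⟨b, hb⟩ := hFbot
      obtain ⟨a, ha⟩ := hFtop
      have A : ∀ n : ℕ, ∀ u ∈ F (b - n) ⊓ W ℓ,
          g u - u ∈ W (ℓ - ((k : ℤ) + 1) - 1) := by
        intro n
        induction n with
        | zero =>
          intro u hu
          have h1 := hu.1
          rw [hb (b - ((0 : ℕ) : ℤ)) (by simp)] at h1
          rw [(Submodule.mem_bot ℂ).1 h1]
          simp
        | succ n ihn =>
          intro u hu
          obtain ⟨x, hx, v, hv, hw⟩ := (hMHS ℓ (b - n)).1 u hu.2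
          have h1 := ihn x hx
          have h2 := ih (ℓ - 1) _ hw
          rw [show ℓ - 1 - ((k : ℤ) + 1) = ℓ - ((k : ℤ) + 1) - 1 by ring] at h2
          refine (hMHS (ℓ - ((k : ℤ) + 1)) (b - ((n + 1 : ℕ) : ℤ))).2 (g u - u)
            ⟨hNF _ _ hu.1, ih _ _ hu.2⟩ (g v - v)
            ⟨hFanti (by push_cast; linarith) (hNF _ _ hv.1), ih _ _ hv.2⟩ ?_
          have h3 := Submodule.add_mem _ h1 h2
          have e : g x - x + (g (u - x - conj v) - (u - x - conj v))
              = g u - u - conj (g v - v) := by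
            rw [hconj_sub, ← hg_conj, map_sub, map_sub]
            abel
          rwa [e] at h3
      intro v hv
      have h := A (b - a).toNat v ⟨by
        rw [ha _ (by have := Int.self_le_toNat (b - a); linarith)]
        trivial, hv⟩
      rwa [show ℓ - (((k + 1 : ℕ) : ℤ) + 1) = ℓ - ((k : ℤ) + 1) - 1 by push_cast; ring]
  obtain ⟨a, ha⟩ := hWbot
  obtain ⟨b, hb⟩ := hWtop
  ext v
  have h := key (b - a).toNat b v (by rw [hb b le_rfl]; trivial)
  rw [ha _ (by have := Int.self_le_toNat (b - a); linarith)] at h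
  exact sub_eq_zero.1 ((Submodule.mem_bot ℂ).1 h)
end

section
/- Let V be a finite-dimensional complex vector space with a bigrading V = ⊕_{p,q ∈ ℤ} V^{p,q} (finitely many nonzero summands). Let g^{p,q} = {ξ ∈ End(V) : ξ(V^{r,s}) ⊆ V^{r+p,s+q} for all r, s}, so End(V) = ⊕_{p,q} g^{p,q}; set F^a = ⊕_{p ≥ a, q} V^{p,q} and f^⊥ = ⊕_{p < 0, q} g^{p,q}. Then every element of f^⊥ is nilpotent, and for x, x' ∈ f^⊥: if exp(x)(F^a) = exp(x')(F^a) for every a ∈ ℤ, then x = x'. -/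
/-- The component `g^{p,q}` of the bigrading of `End V` induced by a bigrading
`V = ⊕ I p q`: endomorphisms mapping each `I r s` into `I (r+p) (s+q)`. -/
def gpq {V : Type*} [AddCommGroup V] [Module ℂ V]
    (I : ℤ → ℤ → Submodule ℂ V) (p q : ℤ) : Submodule ℂ (Module.End ℂ V) where
  carrier := {ξ | ∀ r s : ℤ, ∀ v ∈ I r s, ξ v ∈ I (r + p) (s + q)}
  add_mem' := by
    intro a b ha hb r s v hv
    simpa using Submodule.add_mem _ (ha r s v hv) (hb r s v hv)
  zero_mem' := by
    intro r s v hv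
    simp only [LinearMap.zero_apply]
    exact Submodule.zero_mem _
  smul_mem' := by
    intro c a ha r s v hv
    simpa using Submodule.smul_mem _ c (ha r s v hv)

/-- The Hodge filtration `F a = ⊕_{p ≥ a, q} I p q` of a bigrading. -/
def Fdeg {V : Type*} [AddCommGroup V] [Module ℂ V]
    (I : ℤ → ℤ → Submodule ℂ V) (a : ℤ) : Submodule ℂ V :=
  ⨆ (pq : ℤ × ℤ) (_ : a ≤ pq.1), I pq.1 pq.2

/-- The nilpotent subalgebra `f^⊥ = ⊕_{p < 0, q} g^{p,q}` of `End V`. -/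
def fperp {V : Type*} [AddCommGroup V] [Module ℂ V]
    (I : ℤ → ℤ → Submodule ℂ V) : Submodule ℂ (Module.End ℂ V) :=
  ⨆ (pq : ℤ × ℤ) (_ : pq.1 < 0), gpq I pq.1 pq.2

/-- The exponential `exp x = Σ_{k ≥ 0} x^k / k!` of an endomorphism of a finite-dimensional
vector space; for a nilpotent `x` the series terminates in degree `≤ finrank ℂ V`, so the
truncated sum below is the full exponential. -/
noncomputable def expEnd {V : Type*} [AddCommGroup V] [Module ℂ V]
    [FiniteDimensional ℂ V] (x : Module.End ℂ V) : Module.End ℂ V :=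
  ∑ k ∈ Finset.range (Module.finrank ℂ V + 1), ((k.factorial : ℂ)⁻¹) • x ^ k

/-- The lower filtration. -/
def Wdeg {V : Type*} [AddCommGroup V] [Module ℂ V]
    (I : ℤ → ℤ → Submodule ℂ V) (b : ℤ) : Submodule ℂ V :=
  ⨆ (pq : ℤ × ℤ) (_ : pq.1 ≤ b), I pq.1 pq.2

/-- Endomorphisms lowering the degree by at least `m`. -/
def Low {V : Type*} [AddCommGroup V] [Module ℂ V]
    (I : ℤ → ℤ → Submodule ℂ V) (m : ℕ) : Submodule ℂ (Module.End ℂ V) where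
  carrier := {ξ | ∀ b : ℤ, ∀ v ∈ Wdeg I b, ξ v ∈ Wdeg I (b - m)}
  add_mem' := by
    intro a b ha hb r v hv
    simpa using Submodule.add_mem _ (ha r v hv) (hb r v hv)
  zero_mem' := by
    intro r v hv
    simp only [LinearMap.zero_apply]
    exact Submodule.zero_mem _
  smul_mem' := by
    intro c a ha r v hv
    simpa using Submodule.smul_mem _ c (ha r v hv)

section aux
variable {V : Type*} [AddCommGroup V] [Module ℂ V] {I : ℤ → ℤ → Submodule ℂ V}

theorem Wdeg_mono {a b : ℤ} (h : a ≤ b) : Wdeg I a ≤ Wdeg I b :=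
  iSup₂_le fun pq hpq => le_iSup₂_of_le pq (hpq.trans h) le_rfl

theorem le_Wdeg {p q b : ℤ} (h : p ≤ b) : I p q ≤ Wdeg I b :=
  le_iSup₂_of_le (f := fun (pq : ℤ × ℤ) (_ : pq.1 ≤ b) => I pq.1 pq.2) (p, q) h le_rfl

theorem Low_anti {m n : ℕ} (h : m ≤ n) : Low I n ≤ Low I m :=
  fun _ hξ b v hv => Wdeg_mono (by omega) (hξ b v hv)

theorem Low_mul {m n : ℕ} {x y : Module.End ℂ V} (hx : x ∈ Low I m) (hy : y ∈ Low I n) :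
    x * y ∈ Low I (m + n) := by
  intro b v hv
  have := hx _ _ (hy b v hv)
  rw [Module.End.mul_apply]
  exact Wdeg_mono (by push_cast; omega) this

theorem Low_one : (1 : Module.End ℂ V) ∈ Low I 0 := by
  intro b v hv
  simpa using hv

theorem Low_pow {x : Module.End ℂ V} (hx : x ∈ Low I 1) (n : ℕ) : x ^ n ∈ Low I n := by
  induction n with
  | zero => simpa using Low_one
  | succ n ih => rw [pow_succ]; exact Low_mul ih hx

theorem fperp_le : fperp I ≤ Low I 1 := by
  refine iSup₂_le fun pq hpq ξ hξ b => ?_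
  have : Wdeg I b ≤ (Wdeg I (b - (1 : ℕ))).comap ξ := by
    refine iSup₂_le fun rs hrs v hv => ?_
    exact le_Wdeg (by push_cast; omega) (hξ rs.1 rs.2 v hv)
  exact fun v hv => this hv

theorem pow_sub_mem {x y : Module.End ℂ V} (hx : x ∈ Low I 1) (hy : y ∈ Low I 1) {m : ℕ}
    (h : x - y ∈ Low I m) (k : ℕ) : x ^ (k + 1) - y ^ (k + 1) ∈ Low I (m + k) := by
  induction k with
  | zero => simpa using h
  | succ k ih =>
    have e : x ^ (k + 1 + 1) - y ^ (k + 1 + 1)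
        = x ^ (k + 1) * (x - y) + (x ^ (k + 1) - y ^ (k + 1)) * y := by
      rw [pow_succ x (k + 1), pow_succ y (k + 1)]; noncomm_ring
    rw [e]
    refine Submodule.add_mem _ ?_ (Low_anti (n := m + k + 1) (by omega) (Low_mul ih hy))
    have := Low_mul (Low_pow hx (k + 1)) h
    rwa [add_comm] at this

theorem exists_bounds (hfin : {pq : ℤ × ℤ | I pq.1 pq.2 ≠ ⊥}.Finite)
    (hInternal : DirectSum.IsInternal (fun pq : ℤ × ℤ => I pq.1 pq.2)) :
    ∃ c : ℤ, ∃ n : ℕ, Wdeg I c = ⊤ ∧ Wdeg I (c - n) = ⊥ := by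
  have hf := hfin.image Prod.fst
  obtain ⟨hi, hhi⟩ := hf.bddAbove
  obtain ⟨lo, hlo⟩ := hf.bddBelow
  have key : ∀ pq : ℤ × ℤ, I pq.1 pq.2 ≠ ⊥ → lo ≤ pq.1 ∧ pq.1 ≤ hi := fun pq h =>
    ⟨hlo ⟨pq, h, rfl⟩, hhi ⟨pq, h, rfl⟩⟩
  refine ⟨hi, (hi - lo + 1).toNat, ?_, ?_⟩
  · rw [eq_top_iff, ← hInternal.submodule_iSup_eq_top]
    refine iSup_le fun pq => ?_
    by_cases h : I pq.1 pq.2 = ⊥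
    · rw [h]; exact bot_le
    · exact le_Wdeg (key pq h).2
  · rw [eq_bot_iff]
    refine iSup₂_le fun pq hpq => ?_
    by_contra h
    have := key pq (fun h' => h (h' ▸ le_rfl))
    omega

theorem disj (hInternal : DirectSum.IsInternal (fun pq : ℤ × ℤ => I pq.1 pq.2)) (p : ℤ) :
    Disjoint (Wdeg I (p - 1)) (Fdeg I p) := by
  have h := hInternal.submodule_iSupIndep
  have := h.disjoint_biSup_biSup (s := {pq : ℤ × ℤ | pq.1 ≤ p - 1})
    (t := {pq : ℤ × ℤ | p ≤ pq.1}) (by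
      rw [Set.disjoint_left]; intro pq h1 h2
      simp only [Set.mem_ofPred_eq] at h1 h2; omega)
  exact this

theorem expEnd_sub_one [FiniteDimensional ℂ V] {x : Module.End ℂ V} (hx : x ∈ Low I 1) :
    expEnd x - 1 ∈ Low I 1 := by
  rw [expEnd, Finset.sum_range_succ']
  simp only [Nat.factorial_zero, Nat.cast_one, inv_one, pow_zero, one_smul, add_sub_cancel_right]
  exact Submodule.sum_mem _ fun k _ => Submodule.smul_mem _ _
    (Low_anti (by omega) (Low_pow hx (k + 1)))

end aux

/-- Every element of `f^⊥` is nilpotent, and two elements `x, x'` of `f^⊥` whose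
exponentials move the Hodge filtration `F` identically coincide. -/
theorem fperp_nilpotent_and_exp_determines {V : Type*} [AddCommGroup V] [Module ℂ V]
    [FiniteDimensional ℂ V]
    (I : ℤ → ℤ → Submodule ℂ V)
    (hfin : {pq : ℤ × ℤ | I pq.1 pq.2 ≠ ⊥}.Finite)
    (hInternal : DirectSum.IsInternal (fun pq : ℤ × ℤ => I pq.1 pq.2)) :
    (∀ ξ ∈ fperp I, IsNilpotent ξ) ∧
    (∀ x ∈ fperp I, ∀ x' ∈ fperp I,
      (∀ a : ℤ, Submodule.map (expEnd x) (Fdeg I a) = Submodule.map (expEnd x') (Fdeg I a)) →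
      x = x') := by
  have main : ∀ ξ ∈ Low I ((exists_bounds hfin hInternal).choose_spec.choose), ξ = 0 := by
    obtain ⟨h1, h2⟩ := (exists_bounds hfin hInternal).choose_spec.choose_spec
    intro ξ hξ
    ext v
    have := hξ _ v (h1 ▸ Submodule.mem_top)
    rw [h2] at this
    simpa using this
  obtain ⟨c, n₀, hc, -⟩ := exists_bounds hfin hInternal
  generalize (exists_bounds hfin hInternal).choose_spec.choose = n at main
  refine ⟨fun ξ hξ => ⟨n, main _ (Low_pow (fperp_le hξ) n)⟩, fun x hx x' hx' h => ?_⟩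
  replace hx := fperp_le hx
  replace hx' := fperp_le hx'
  have hA := expEnd_sub_one hx
  have hB := expEnd_sub_one hx'
  have desc : ∀ (b : ℤ) (u : V), expEnd x u ∈ Wdeg I b → u ∈ Wdeg I b := by
    intro b u hu
    have : ∀ k : ℕ, u ∈ Wdeg I (max b (c - k)) := by
      intro k
      induction k with
      | zero => exact Wdeg_mono (by simp) (hc ▸ Submodule.mem_top : u ∈ Wdeg I c)
      | succ k ih =>
        by_cases hk : c - k ≤ b
        · exact Wdeg_mono (by omega) ih
        · have h1 := hA _ _ ih
          have h2 : u = expEnd x u - (expEnd x - 1) u := by simp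
          rw [h2]
          exact Submodule.sub_mem _ (Wdeg_mono (by omega) hu)
            (Wdeg_mono (by push_cast; omega) h1)
    exact Wdeg_mono (by omega) (this (c - b).toNat)
  have hEq : expEnd x = expEnd x' := by
    have hle : (⊤ : Submodule ℂ V) ≤ LinearMap.eqLocus (expEnd x) (expEnd x') := by
      rw [← hInternal.submodule_iSup_eq_top]
      refine iSup_le fun pq v hv => ?_
      have hvF : v ∈ Fdeg I pq.1 :=
        le_iSup₂_of_le (f := fun (rs : ℤ × ℤ) (_ : pq.1 ≤ rs.1) => I rs.1 rs.2) pq le_rfl le_rfl hv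
      have hvW : v ∈ Wdeg I pq.1 := le_Wdeg le_rfl hv
      have hm : expEnd x' v ∈ Submodule.map (expEnd x) (Fdeg I pq.1) := by
        rw [h]; exact Submodule.mem_map_of_mem hvF
      obtain ⟨w, hw, hwv⟩ := hm
      have hu : expEnd x (w - v) ∈ Wdeg I (pq.1 - 1) := by
        have e : expEnd x (w - v) = (expEnd x' - 1) v - (expEnd x - 1) v := by
          simp [hwv]
        rw [e]
        exact Submodule.sub_mem _ (hB _ _ hvW) (hA _ _ hvW)
      have h0 := (Submodule.disjoint_def.1 (disj hInternal pq.1)) _ (desc _ _ hu)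
        (Submodule.sub_mem _ hw hvF)
      rw [sub_eq_zero] at h0
      rw [LinearMap.mem_eqLocus, ← hwv, h0]
    exact LinearMap.ext fun v => hle Submodule.mem_top
  rcases Nat.eq_zero_or_pos (Module.finrank ℂ V) with hd | hd
  · have := Module.finrank_zero_iff.1 hd
    exact Subsingleton.elim _ _
  have step : ∀ m : ℕ, x - x' ∈ Low I (m + 1) := by
    intro m
    induction m with
    | zero => simpa using Submodule.sub_mem _ hx hx'
    | succ m ih =>
      obtain ⟨d, hd'⟩ : ∃ d, Module.finrank ℂ V = d + 1 := ⟨_, (Nat.succ_pred_eq_of_pos hd).symm⟩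
      rw [expEnd, expEnd, hd', Finset.sum_range_succ', Finset.sum_range_succ',
        Finset.sum_range_succ', Finset.sum_range_succ'] at hEq
      simp only [zero_add, pow_zero, pow_one, Nat.factorial_zero, Nat.factorial_one, Nat.cast_one,
        inv_one, one_smul, add_left_inj] at hEq
      have e : x - x' = - ∑ k ∈ Finset.range d, (((k + 1 + 1).factorial : ℂ)⁻¹) •
          (x ^ (k + 1 + 1) - x' ^ (k + 1 + 1)) := by
        simp only [smul_sub, Finset.sum_sub_distrib]
        rw [neg_sub, sub_eq_sub_iff_add_eq_add, add_comm, hEq]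
      rw [e]
      exact Submodule.neg_mem _ (Submodule.sum_mem _ fun k _ => Submodule.smul_mem _ _
        (Low_anti (by omega) (pow_sub_mem hx hx' ih (k + 1))))
  exact sub_eq_zero.1 (main _ (Low_anti (by omega) (step n)))
end

section
/- Let V be a finite-dimensional complex vector space with a bigrading V = ⊕_{p,q} V^{p,q}, with induced bigrading End(V) = ⊕ g^{p,q}, Hodge filtration F^a = ⊕_{p ≥ a, q} V^{p,q}, and f^⊥ = ⊕_{p < 0, q} g^{p,q}. For ξ ∈ End(V) write ξ^{p,q} for its component in g^{p,q}. Let b, x ∈ End(V) satisfy b^{p,q} = 0 and x^{p,q} = 0 whenever p + q ≥ 0, and assume x ∈ f^⊥. Then there exists a unique y ∈ f^⊥ with y^{p,q} = 0 whenever p + q ≥ 0 such that exp(b)·exp(x)(F^a) = exp(y)(F^a) for every a ∈ ℤ; moreover, for every p ≥ 1 its components of total degree −1 satisfy y^{−p,p−1} = x^{−p,p−1} + b^{−p,p−1}. -/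
structure ESys {R : Type*} [Ring R] (e : ℤ × ℤ → R) (S : Finset (ℤ × ℤ)) : Prop where
  off : ∀ i, i ∉ S → e i = 0
  idem : ∀ i, e i * e i = e i
  orth : ∀ i j, i ≠ j → e i * e j = 0
  total : ∑ i ∈ S, e i = 1

def Afil {R : Type*} [Ring R] [Algebra ℂ R] (e : ℤ × ℤ → R) (k : ℕ) : Submodule ℂ R where
  carrier := {T | ∀ i j : ℤ × ℤ, -(k : ℤ) < (i.1 + i.2) - (j.1 + j.2) → e i * T * e j = 0}
  add_mem' := by
    intro a b ha hb i j h
    rw [mul_add, add_mul, ha i j h, hb i j h, add_zero]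
  zero_mem' := by
    intro i j h
    simp
  smul_mem' := by
    intro c a ha i j h
    rw [mul_smul_comm, smul_mul_assoc, ha i j h, smul_zero]

section ring
variable {R : Type*} [Ring R] [Algebra ℂ R] {e : ℤ × ℤ → R} {S : Finset (ℤ × ℤ)}

theorem Afil_iff {k : ℕ} {T : R} : T ∈ Afil e k ↔
    ∀ i j : ℤ × ℤ, -(k : ℤ) < (i.1 + i.2) - (j.1 + j.2) → e i * T * e j = 0 := Iff.rfl

theorem ESys.mul_entry (h : ESys e S) (T U : R) (i j : ℤ × ℤ) :
    e i * (T * U) * e j = ∑ k ∈ S, (e i * T * e k) * (e k * U * e j) := by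
  have h1 : e i * (T * U) * e j = e i * T * (∑ k ∈ S, e k) * U * e j := by
    rw [h.total]; noncomm_ring
  rw [h1, Finset.mul_sum, Finset.sum_mul, Finset.sum_mul]
  refine Finset.sum_congr rfl fun k _ => ?_
  have : e i * T * e k * (e k * U * e j) = e i * T * (e k * e k) * U * e j := by noncomm_ring
  rw [this, h.idem]

theorem ESys.decomp (h : ESys e S) (T : R) :
    T = ∑ i ∈ S, ∑ j ∈ S, e i * T * e j := by
  have : T = (∑ i ∈ S, e i) * T * (∑ j ∈ S, e j) := by rw [h.total]; simp
  conv_lhs => rw [this]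
  simp_rw [Finset.sum_mul, Finset.mul_sum]

theorem ESys.ext0 (h : ESys e S) {T : R} (hT : ∀ i j, e i * T * e j = 0) : T = 0 := by
  rw [h.decomp T]
  exact Finset.sum_eq_zero fun i _ => Finset.sum_eq_zero fun j _ => hT i j

theorem ESys.ext1 (h : ESys e S) {T U : R} (hT : ∀ i j, e i * T * e j = e i * U * e j) :
    T = U := by
  refine sub_eq_zero.1 (h.ext0 fun i j => ?_)
  rw [mul_sub, sub_mul, hT, sub_self]

/-- projection to the entries with `D i j` -/
theorem ESys.proj_entry (h : ESys e S) (D : ℤ × ℤ → ℤ × ℤ → Prop)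
    [∀ i j, Decidable (D i j)] (T : R) (i j : ℤ × ℤ) :
    e i * (∑ k ∈ S, ∑ l ∈ S, if D k l then e k * T * e l else 0) * e j =
      if D i j then e i * T * e j else 0 := by
  by_cases hi : i ∈ S
  swap
  · simp [h.off i hi]
  by_cases hj : j ∈ S
  swap
  · simp [h.off j hj]
  simp_rw [Finset.mul_sum, Finset.sum_mul]
  rw [Finset.sum_eq_single i, Finset.sum_eq_single j]
  · split_ifs
    · have : e i * (e i * T * e j) * e j = (e i * e i) * T * (e j * e j) := by noncomm_ring
      rw [this, h.idem, h.idem]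
    · simp
  · intro l _ hl
    split_ifs
    · have : e i * (e i * T * e l) * e j = (e i * e i) * T * (e l * e j) := by noncomm_ring
      rw [this, h.orth l j hl, mul_zero]
    · simp
  · intro h'; exact absurd hj h'
  · intro k _ hk
    refine Finset.sum_eq_zero fun l _ => ?_
    split_ifs
    · have : e i * (e k * T * e l) * e j = (e i * e k) * T * (e l * e j) := by noncomm_ring
      rw [this, h.orth i k (Ne.symm hk), zero_mul, zero_mul]
    · simp
  · intro h'; exact absurd hi h'

theorem Afil_anti {k l : ℕ} (hkl : k ≤ l) {T : R} (hT : T ∈ Afil e l) : T ∈ Afil e k :=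
  fun i j h => hT i j (by omega)

theorem ESys.mul_mem (h : ESys e S) {k l : ℕ} {T U : R} (hT : T ∈ Afil e k) (hU : U ∈ Afil e l) :
    T * U ∈ Afil e (k + l) := by
  intro i j hij
  rw [h.mul_entry]
  refine Finset.sum_eq_zero fun m _ => ?_
  by_cases hc : -(k : ℤ) < (i.1 + i.2) - (m.1 + m.2)
  · rw [hT i m hc, zero_mul]
  · rw [hU m j (by push_cast at hij; omega), mul_zero]

theorem ESys.one_mem (h : ESys e S) : (1 : R) ∈ Afil e 0 := by
  intro i j hij
  rw [mul_one]
  apply h.orth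
  rintro rfl
  simp at hij

theorem ESys.pow_mem (h : ESys e S) {T : R} (hT : T ∈ Afil e 1) (m : ℕ) : T ^ m ∈ Afil e m := by
  induction m with
  | zero => simpa using h.one_mem
  | succ m ih => rw [pow_succ]; exact h.mul_mem ih hT

theorem ESys.exists_bot (h : ESys e S) : ∃ K : ℕ, ∀ T ∈ Afil e K, T = 0 := by
  obtain ⟨M, hM⟩ : ∃ M : ℕ, ∀ i ∈ S, |i.1 + i.2| ≤ M := by
    refine ⟨S.sup (fun i => (i.1 + i.2).natAbs), fun i hi => ?_⟩
    have := Finset.le_sup (f := fun i : ℤ × ℤ => (i.1 + i.2).natAbs) hi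
    rw [Int.abs_eq_natAbs]
    exact_mod_cast this
  refine ⟨2 * M + 1, fun T hT => h.ext0 fun i j => ?_⟩
  by_cases hi : i ∈ S
  swap
  · simp [h.off i hi]
  by_cases hj : j ∈ S
  swap
  · simp [h.off j hj]
  apply hT
  have h1 := abs_le.1 (hM i hi)
  have h2 := abs_le.1 (hM j hj)
  push_cast
  omega

theorem ESys.nilp (h : ESys e S) {T : R} (hT : T ∈ Afil e 1) : IsNilpotent T := by
  obtain ⟨K, hK⟩ := h.exists_bot
  exact ⟨K, hK _ (h.pow_mem hT K)⟩

theorem ESys.pow_diff (h : ESys e S) {k : ℕ} (hk : 1 ≤ k) {y z : R} (hy : y ∈ Afil e 1)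
    (hz : z ∈ Afil e k) (m : ℕ) : (y + z) ^ m - y ^ m ∈ Afil e k := by
  induction m with
  | zero => simp
  | succ m ih =>
    have : (y + z) ^ (m + 1) - y ^ (m + 1) = ((y + z) ^ m - y ^ m) * (y + z) + y ^ m * z := by
      rw [pow_succ, pow_succ]; noncomm_ring
    rw [this]
    refine Submodule.add_mem _ (Afil_anti (Nat.le_succ k) (h.mul_mem ih
      (Submodule.add_mem _ hy (Afil_anti hk hz)))) ?_
    exact Afil_anti (by omega) (h.mul_mem (h.pow_mem hy m) hz)

theorem ESys.pow_diff2 (h : ESys e S) {k : ℕ} (hk : 1 ≤ k) {y z : R} (hy : y ∈ Afil e 1)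
    (hz : z ∈ Afil e k) (m : ℕ) : (y + z) ^ (m + 2) - y ^ (m + 2) ∈ Afil e (k + 1) := by
  have : (y + z) ^ (m + 2) - y ^ (m + 2) =
      ((y + z) ^ (m + 1) - y ^ (m + 1)) * (y + z) + y ^ (m + 1) * z := by
    rw [pow_succ _ (m + 1), pow_succ y (m + 1)]; noncomm_ring
  rw [this]
  refine Submodule.add_mem _ (h.mul_mem (h.pow_diff hk hy hz _)
      (Submodule.add_mem _ hy (Afil_anti hk hz))) ?_
  exact Afil_anti (by omega) (h.mul_mem (h.pow_mem hy (m + 1)) hz)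

end ring

section vec
variable {V : Type*} [AddCommGroup V] [Module ℂ V] [FiniteDimensional ℂ V]
  {e : ℤ × ℤ → Module.End ℂ V} {S : Finset (ℤ × ℤ)}

theorem ESys.exp_diff (h : ESys e S) {k : ℕ} (hk : 1 ≤ k) {y z : Module.End ℂ V}
    (hy : y ∈ Afil e 1) (hz : z ∈ Afil e k) :
    expEnd (y + z) - expEnd y - z ∈ Afil e (k + 1) := by
  rcases Nat.eq_zero_or_pos (Module.finrank ℂ V) with h0 | hpos
  · haveI : Subsingleton V := Module.finrank_zero_iff.1 h0
    have : expEnd (y + z) - expEnd y - z = 0 := by ext v; exact Subsingleton.elim _ _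
    rw [this]; exact Submodule.zero_mem _
  · obtain ⟨n, hn⟩ : ∃ n, Module.finrank ℂ V = n + 1 := ⟨_, (Nat.sub_add_cancel hpos).symm⟩
    have key : expEnd (y + z) - expEnd y - z =
        ∑ m ∈ Finset.range n, (((m + 2).factorial : ℂ)⁻¹) • ((y + z) ^ (m + 2) - y ^ (m + 2)) := by
      unfold expEnd
      rw [hn]
      simp only [Finset.sum_range_succ', smul_sub, Finset.sum_sub_distrib]
      simp
      abel
    rw [key]
    exact Submodule.sum_mem _ fun m _ => Submodule.smul_mem _ _ (h.pow_diff2 hk hy hz m)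

theorem expEnd_zero' : expEnd (0 : Module.End ℂ V) = 1 := by
  unfold expEnd
  rw [Finset.sum_range_succ']
  simp

theorem expEnd_eq [Module ℚ (Module.End ℂ V)] {y : Module.End ℂ V} (hy : IsNilpotent y) : expEnd y = IsNilpotent.exp y := by
  have h0 : y ^ (Module.finrank ℂ V + 1) = 0 := by
    obtain ⟨n, hn⟩ := hy
    have h1 : LinearMap.ker (y ^ (Module.finrank ℂ V + 1 + n)) =
        LinearMap.ker (y ^ (Module.finrank ℂ V + 1)) := by
      rw [Module.End.ker_pow_eq_ker_pow_finrank_of_le (by omega),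
        ← Module.End.ker_pow_eq_ker_pow_finrank_of_le (m := Module.finrank ℂ V + 1) (by omega)]
    rw [pow_add, hn, mul_zero, LinearMap.ker_zero] at h1
    exact LinearMap.ker_eq_top.1 h1.symm
  rw [IsNilpotent.exp_eq_sum h0]
  unfold expEnd
  refine Finset.sum_congr rfl fun k _ => ?_
  rw [← Rat.cast_smul_eq_qsmul ℂ ((k.factorial : ℚ)⁻¹) (y ^ k)]
  simp

theorem ESys.exp_neg (h : ESys e S) {y : Module.End ℂ V} (hy : y ∈ Afil e 1) :
    expEnd (-y) * expEnd y = 1 ∧ expEnd y * expEnd (-y) = 1 := by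
  have hn := h.nilp hy
  letI : Algebra ℚ (Module.End ℂ V) := Algebra.compHom _ (algebraMap ℚ ℂ)
  rw [expEnd_eq hn, expEnd_eq hn.neg]
  exact ⟨IsNilpotent.exp_neg_mul_exp_self hn, IsNilpotent.exp_mul_exp_neg_self hn⟩

theorem ESys.exp_sub (h : ESys e S) {y : Module.End ℂ V} (hy : y ∈ Afil e 1) :
    expEnd y - 1 - y ∈ Afil e 2 := by
  have := h.exp_diff (k := 1) le_rfl (Submodule.zero_mem (Afil e 1)) hy
  rwa [zero_add, expEnd_zero'] at this

theorem ESys.g_sub (h : ESys e S) {b x : Module.End ℂ V} (hb : b ∈ Afil e 1)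
    (hx : x ∈ Afil e 1) : expEnd b * expEnd x - 1 - (b + x) ∈ Afil e 2 := by
  have h1 := h.exp_sub hb
  have h2 := h.exp_sub hx
  have hx1 : expEnd x - 1 ∈ Afil e 1 := by
    have := Submodule.add_mem _ (Afil_anti (k := 1) (by omega) h2) hx
    simpa using this
  have : expEnd b * expEnd x - 1 - (b + x) =
      (expEnd b - 1 - b) * (expEnd x - 1) + b * (expEnd x - 1) +
      (expEnd b - 1 - b) + (expEnd x - 1 - x) := by noncomm_ring
  rw [this]
  refine Submodule.add_mem _ (Submodule.add_mem _ (Submodule.add_mem _ ?_ ?_) h1) h2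
  · exact Afil_anti (by omega) (h.mul_mem h1 hx1)
  · exact h.mul_mem hb hx1

theorem ESys.main_diff (h : ESys e S) {k : ℕ} (hk : 1 ≤ k) {y z g : Module.End ℂ V}
    (hy : y ∈ Afil e 1) (hz : z ∈ Afil e k) (hg : g - 1 ∈ Afil e 1) :
    expEnd (-(y + z)) * g - expEnd (-y) * g + z ∈ Afil e (k + 1) := by
  have h1 := h.exp_diff hk (Submodule.neg_mem _ hy) (Submodule.neg_mem _ hz)
  have hg0 : g ∈ Afil e 0 := by
    have := Submodule.add_mem _ (Afil_anti (k := 0) (by omega) hg) h.one_mem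
    simpa using this
  have : expEnd (-(y + z)) * g - expEnd (-y) * g + z =
      (expEnd (-y + -z) - expEnd (-y) - -z) * g - z * (g - 1) := by
    rw [neg_add]; noncomm_ring
  rw [this]
  exact Submodule.sub_mem _ (Afil_anti (by omega) (h.mul_mem h1 hg0)) (h.mul_mem hz hg)

theorem ESys.exists_y (h : ESys e S) {g : Module.End ℂ V} (hg : g - 1 ∈ Afil e 1) (k : ℕ) :
    ∃ y ∈ Afil e 1, (∀ i j : ℤ × ℤ, j.1 ≤ i.1 → e i * y * e j = 0) ∧
      ∀ i j : ℤ × ℤ, i.1 < j.1 → -((k + 1 : ℕ) : ℤ) < (i.1 + i.2) - (j.1 + j.2) →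
        e i * (expEnd (-y) * g) * e j = 0 := by
  induction k with
  | zero =>
    refine ⟨0, Submodule.zero_mem _, by simp, fun i j hij hd => ?_⟩
    have h1 := hg i j (by simpa using hd)
    rw [mul_sub, sub_mul, mul_one, h.orth i j (by rintro rfl; simp at hij), sub_zero] at h1
    rw [neg_zero, expEnd_zero', one_mul, h1]
  | succ k ih =>
    obtain ⟨y, hy, hyN, hyk⟩ := ih
    set z := ∑ i ∈ S, ∑ j ∈ S, if i.1 < j.1 then e i * (expEnd (-y) * g) * e j else 0 with hz
    have hze : ∀ i j, e i * z * e j = if i.1 < j.1 then e i * (expEnd (-y) * g) * e j else 0 :=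
      fun i j => h.proj_entry (fun i j => i.1 < j.1) _ i j
    have hzA : z ∈ Afil e (k + 1) := by
      intro i j hd
      rw [hze]
      split_ifs with hc
      · exact hyk i j hc hd
      · rfl
    refine ⟨y + z, Submodule.add_mem _ hy (Afil_anti (by omega) hzA), fun i j hij => ?_,
      fun i j hij hd => ?_⟩
    · rw [mul_add, add_mul, hyN i j hij, hze, if_neg (by omega), add_zero]
    · have := h.main_diff (by omega) hy hzA hg i j hd
      rw [mul_add, add_mul, mul_sub, sub_mul, hze, if_pos hij, sub_add_cancel] at this
      exact this

theorem ESys.unique_y (h : ESys e S) {g : Module.End ℂ V} (hg : g - 1 ∈ Afil e 1)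
    {y y' : Module.End ℂ V} (hy : y ∈ Afil e 1) (hy' : y' ∈ Afil e 1)
    (hyN : ∀ i j : ℤ × ℤ, j.1 ≤ i.1 → e i * y * e j = 0)
    (hyN' : ∀ i j : ℤ × ℤ, j.1 ≤ i.1 → e i * y' * e j = 0)
    (h1 : ∀ i j : ℤ × ℤ, i.1 < j.1 → e i * (expEnd (-y) * g) * e j = 0)
    (h1' : ∀ i j : ℤ × ℤ, i.1 < j.1 → e i * (expEnd (-y') * g) * e j = 0) : y' = y := by
  have key : ∀ k : ℕ, y' - y ∈ Afil e (k + 1) := by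
    intro k
    induction k with
    | zero => exact Submodule.sub_mem _ hy' hy
    | succ k ih =>
      intro i j hd
      rcases lt_or_ge i.1 j.1 with hc | hc
      · have := h.main_diff (by omega) hy ih hg i j hd
        rw [add_sub_cancel, mul_add, add_mul, mul_sub, sub_mul, h1 i j hc, h1' i j hc,
          sub_zero, zero_add] at this
        exact this
      · rw [mul_sub, sub_mul, hyN i j hc, hyN' i j hc, sub_zero]
  obtain ⟨K, hK⟩ := h.exists_bot
  exact sub_eq_zero.1 (hK _ (Afil_anti (Nat.le_succ K) (key K)))

theorem ESys.deg_one (h : ESys e S) {b x y : Module.End ℂ V} (hb : b ∈ Afil e 1)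
    (hx : x ∈ Afil e 1) (hg : expEnd b * expEnd x - 1 ∈ Afil e 1) (hy : y ∈ Afil e 1)
    (h1 : ∀ i j : ℤ × ℤ, i.1 < j.1 → e i * (expEnd (-y) * (expEnd b * expEnd x)) * e j = 0)
    (i j : ℤ × ℤ) (hij : i.1 < j.1) (hd : -(2 : ℤ) < (i.1 + i.2) - (j.1 + j.2)) :
    e i * y * e j = e i * x * e j + e i * b * e j := by
  have h2 := h.main_diff (k := 1) le_rfl (Submodule.zero_mem (Afil e 1)) hy hg i j (by simpa using hd)
  have h3 := h.g_sub hb hx i j (by simpa using hd)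
  rw [zero_add, neg_zero, expEnd_zero', one_mul, mul_add, add_mul, mul_sub, sub_mul,
    h1 i j hij, zero_sub, neg_add_eq_zero] at h2
  rw [mul_sub, sub_mul, mul_sub, sub_mul, mul_one, h.orth i j (by rintro rfl; simp at hij),
    sub_zero, h2, mul_add, add_mul, sub_eq_zero] at h3
  rw [h3, add_comm]

/-- the grading data -/
structure EGr (I : ℤ → ℤ → Submodule ℂ V) (e : ℤ × ℤ → Module.End ℂ V) : Prop where
  mem : ∀ i v, e i v ∈ I i.1 i.2
  same : ∀ i, ∀ v ∈ I i.1 i.2, e i v = v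
  other : ∀ i j, i ≠ j → ∀ v ∈ I j.1 j.2, e i v = 0

theorem exists_ESys (I : ℤ → ℤ → Submodule ℂ V)
    (hfin : {pq : ℤ × ℤ | I pq.1 pq.2 ≠ ⊥}.Finite)
    (hInternal : DirectSum.IsInternal (fun pq : ℤ × ℤ => I pq.1 pq.2)) :
    ∃ (e : ℤ × ℤ → Module.End ℂ V) (S : Finset (ℤ × ℤ)), ESys e S ∧ EGr I e := by
  classical
  letI := hInternal.chooseDecomposition
  let J : ℤ × ℤ → Submodule ℂ V := fun pq => I pq.1 pq.2
  let e : ℤ × ℤ → Module.End ℂ V := fun i =>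
    (J i).subtype ∘ₗ DirectSum.component ℂ (ℤ × ℤ) (fun i => J i) i ∘ₗ
      (DirectSum.decomposeLinearEquiv J).toLinearMap
  have he : ∀ i v, e i v = (DirectSum.decompose J v i : V) := fun i v => rfl
  have hG : EGr I e := by
    refine ⟨fun i v => ?_, fun i v hv => ?_, fun i j hij v hv => ?_⟩
    · rw [he]; exact (DirectSum.decompose J v i).2
    · rw [he]; exact DirectSum.decompose_of_mem_same J hv
    · rw [he]; exact DirectSum.decompose_of_mem_ne J hv (Ne.symm hij)
  have hoff : ∀ i, i ∉ hfin.toFinset → e i = 0 := by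
    intro i hi
    simp only [Set.Finite.mem_toFinset, Set.mem_setOf_eq, not_not] at hi
    ext v
    have := hG.mem i v
    rw [hi] at this
    simpa using this
  refine ⟨e, hfin.toFinset, ⟨hoff, fun i => ?_, fun i j hij => ?_, ?_⟩, hG⟩
  · ext v
    exact hG.same i _ (hG.mem i v)
  · ext v
    exact hG.other i j hij _ (hG.mem j v)
  · ext v
    rw [LinearMap.sum_apply]
    conv_rhs => rw [Module.End.one_apply, ← DirectSum.sum_support_decompose J v]
    symm
    apply Finset.sum_subset
    · intro i hi
      by_contra hc
      have := LinearMap.congr_fun (hoff i hc) v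
      rw [he] at this
      rw [DFinsupp.mem_support_iff] at hi
      exact hi (Subtype.ext this)
    · intro i _ hi
      rw [DFinsupp.notMem_support_iff] at hi
      rw [hi]; rfl

variable {I : ℤ → ℤ → Submodule ℂ V}

theorem sum_apply' (h : ESys e S) (v : V) : v = ∑ i ∈ S, e i v := by
  have := LinearMap.congr_fun h.total v
  rw [LinearMap.sum_apply] at this
  exact this.symm

theorem mem_I (h : ESys e S) (hG : EGr I e) (i : ℤ × ℤ) (v : V) (hv : ∀ j, j ≠ i → e j v = 0) :
    v ∈ I i.1 i.2 := by
  rw [sum_apply' h v]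
  refine Submodule.sum_mem _ fun j _ => ?_
  by_cases hj : j = i
  · subst hj; exact hG.mem j v
  · rw [hv j hj]; exact Submodule.zero_mem _

theorem gpq_iff (h : ESys e S) (hG : EGr I e) (p : ℤ × ℤ) (T : Module.End ℂ V) :
    T ∈ gpq I p.1 p.2 ↔ ∀ i j, i - j ≠ p → e i * T * e j = 0 := by
  constructor
  · intro hT i j hij
    ext v
    have h1 : T (e j v) ∈ I (j.1 + p.1) (j.2 + p.2) := hT _ _ _ (hG.mem j v)
    refine hG.other i (j + p) ?_ _ h1
    rintro rfl
    simp at hij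
  · intro hT r s v hv
    refine mem_I h hG ((r, s) + p) _ fun j hj => ?_
    have h1 := LinearMap.congr_fun (hT j (r, s) (by rintro rfl; simp at hj)) v
    have h2 : e (r, s) v = v := hG.same (r, s) v hv
    simpa [h2] using h1

theorem Fdeg_iff (h : ESys e S) (hG : EGr I e) (a : ℤ) (v : V) :
    v ∈ Fdeg I a ↔ ∀ i : ℤ × ℤ, i.1 < a → e i v = 0 := by
  constructor
  · intro hv i hi
    have : Fdeg I a ≤ LinearMap.ker (e i) := by
      refine iSup₂_le fun j hj w hw => ?_
      exact hG.other i j (by rintro rfl; omega) w hw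
    exact this hv
  · intro hv
    rw [sum_apply' h v]
    refine Submodule.sum_mem _ fun i _ => ?_
    by_cases hi : i.1 < a
    · rw [hv i hi]; exact Submodule.zero_mem _
    · exact (le_iSup₂_of_le (f := fun (pq : ℤ × ℤ) (_ : a ≤ pq.1) => I pq.1 pq.2)
        i (not_lt.1 hi) le_rfl) (hG.mem i v)

theorem presF_iff (h : ESys e S) (hG : EGr I e) (T : Module.End ℂ V) :
    (∀ a, Submodule.map T (Fdeg I a) ≤ Fdeg I a) ↔
      ∀ i j : ℤ × ℤ, i.1 < j.1 → e i * T * e j = 0 := by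
  constructor
  · intro hT i j hij
    ext v
    have h1 : e j v ∈ Fdeg I j.1 := (Fdeg_iff h hG _ _).2 fun k hk =>
      hG.other k j (by rintro rfl; omega) _ (hG.mem j v)
    exact (Fdeg_iff h hG _ _).1 (hT _ (Submodule.mem_map_of_mem h1)) i hij
  · rintro hT a _ ⟨v, hv, rfl⟩
    rw [Fdeg_iff h hG]
    intro i hi
    have hv' := (Fdeg_iff h hG a v).1 hv
    rw [sum_apply' h v, map_sum, map_sum]
    refine Finset.sum_eq_zero fun j _ => ?_
    by_cases hj : j.1 < a
    · rw [hv' j hj]; simp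
    · exact LinearMap.congr_fun (hT i j (by omega)) v

theorem flag_iff (h : ESys e S) (hG : EGr I e) {b x y : Module.End ℂ V} (hb : b ∈ Afil e 1)
    (hx : x ∈ Afil e 1) (hy : y ∈ Afil e 1) :
    (∀ a : ℤ, Submodule.map (expEnd y) (Fdeg I a) =
        Submodule.map (expEnd b * expEnd x) (Fdeg I a)) ↔
      ∀ i j : ℤ × ℤ, i.1 < j.1 → e i * (expEnd (-y) * (expEnd b * expEnd x)) * e j = 0 := by
  rw [← presF_iff h hG]
  set g := expEnd b * expEnd x with hg
  have mm : ∀ (A B : Module.End ℂ V) (W : Submodule ℂ V),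
      Submodule.map (A * B) W = Submodule.map A (Submodule.map B W) :=
    fun A B W => Submodule.map_comp B A W
  have m1 : ∀ W : Submodule ℂ V, Submodule.map (1 : Module.End ℂ V) W = W :=
    fun W => Submodule.map_id W
  constructor
  · intro hh a
    rw [mm, ← hh a, ← mm, (h.exp_neg hy).1, m1]
  · intro hh a
    have hinj : Function.Injective (expEnd (-y) * g) := by
      have hl : (expEnd (-x) * expEnd (-b) * expEnd y) * (expEnd (-y) * g) = 1 := by
        calc _ = expEnd (-x) * (expEnd (-b) * (expEnd y * expEnd (-y)) * expEnd b) * expEnd x := by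
              rw [hg]; noncomm_ring
          _ = 1 := by rw [(h.exp_neg hy).2, mul_one, (h.exp_neg hb).1, mul_one, (h.exp_neg hx).1]
      intro u v huv
      have h1 := LinearMap.congr_fun hl u
      have h2 := LinearMap.congr_fun hl v
      rw [Module.End.mul_apply, huv, ← Module.End.mul_apply, h2] at h1
      exact h1.symm
    have heq : Submodule.map (expEnd (-y) * g) (Fdeg I a) = Fdeg I a :=
      Submodule.eq_of_le_of_finrank_eq (hh a) 
        (LinearEquiv.finrank_eq (Submodule.equivMapOfInjective _ hinj _)).symm
    conv_lhs => rw [← heq]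
    rw [← mm, ← mul_assoc, (h.exp_neg hy).2, one_mul]

theorem entry_finsum (h : ESys e S) (hG : EGr I e) {β : ℤ × ℤ → Module.End ℂ V}
    (hβfin : (Function.support β).Finite) (hβmem : ∀ pq : ℤ × ℤ, β pq ∈ gpq I pq.1 pq.2)
    (i j : ℤ × ℤ) : e i * (∑ᶠ pq, β pq) * e j = e i * β (i - j) * e j := by
  rw [finsum_eq_sum _ hβfin, Finset.mul_sum, Finset.sum_mul, Finset.sum_eq_single (i - j)]
  · intro p _ hp
    exact (gpq_iff h hG p _).1 (hβmem p) i j (Ne.symm hp)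
  · intro hc
    simp only [Set.Finite.mem_toFinset, Function.mem_support, not_not] at hc
    rw [hc]; simp

theorem fam_mem (h : ESys e S) (hG : EGr I e) {β : ℤ × ℤ → Module.End ℂ V}
    (hβfin : (Function.support β).Finite) (hβmem : ∀ pq : ℤ × ℤ, β pq ∈ gpq I pq.1 pq.2)
    (hβneg : ∀ pq : ℤ × ℤ, 0 ≤ pq.1 + pq.2 → β pq = 0) : (∑ᶠ pq, β pq) ∈ Afil e 1 := by
  intro i j hd
  rw [entry_finsum h hG hβfin hβmem, hβneg (i - j)]
  · simp
  · simp only [Prod.fst_sub, Prod.snd_sub]; push_cast at hd; omega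

theorem fam_N (h : ESys e S) (hG : EGr I e) {β : ℤ × ℤ → Module.End ℂ V}
    (hβfin : (Function.support β).Finite) (hβmem : ∀ pq : ℤ × ℤ, β pq ∈ gpq I pq.1 pq.2)
    (hβneg : ∀ pq : ℤ × ℤ, 0 ≤ pq.1 → β pq = 0) (i j : ℤ × ℤ) (hij : j.1 ≤ i.1) :
    e i * (∑ᶠ pq, β pq) * e j = 0 := by
  rw [entry_finsum h hG hβfin hβmem, hβneg (i - j)]
  · simp
  · simp only [Prod.fst_sub]; omega

end vec

/-- Given `b` with bigraded components only in total degrees `p + q ≤ -1` and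
`x ∈ f^⊥` with components only in total degrees `p + q ≤ -1` (presented through their
finitely supported component families `β`, `ξ`), there is a unique `y ∈ f^⊥` with
components only in total degrees `p + q ≤ -1` such that
`exp b (exp x (F a)) = exp y (F a)` for all `a`; moreover its components of total
degree `-1` satisfy `y^{-p,p-1} = x^{-p,p-1} + b^{-p,p-1}` for all `p ≥ 1`. -/
theorem exp_normal_form_degree_neg_one_components {V : Type*} [AddCommGroup V] [Module ℂ V]
    [FiniteDimensional ℂ V]
    (I : ℤ → ℤ → Submodule ℂ V)
    (hfin : {pq : ℤ × ℤ | I pq.1 pq.2 ≠ ⊥}.Finite)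
    (hInternal : DirectSum.IsInternal (fun pq : ℤ × ℤ => I pq.1 pq.2))
    (β ξ : ℤ × ℤ → Module.End ℂ V)
    (hβfin : (Function.support β).Finite) (hξfin : (Function.support ξ).Finite)
    (hβmem : ∀ pq : ℤ × ℤ, β pq ∈ gpq I pq.1 pq.2)
    (hξmem : ∀ pq : ℤ × ℤ, ξ pq ∈ gpq I pq.1 pq.2)
    (hβneg : ∀ pq : ℤ × ℤ, 0 ≤ pq.1 + pq.2 → β pq = 0)
    (hξneg : ∀ pq : ℤ × ℤ, 0 ≤ pq.1 + pq.2 → ξ pq = 0)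
    (hξhoriz : ∀ pq : ℤ × ℤ, 0 ≤ pq.1 → ξ pq = 0)
    (b x : Module.End ℂ V)
    (hb : b = ∑ᶠ pq : ℤ × ℤ, β pq) (hx : x = ∑ᶠ pq : ℤ × ℤ, ξ pq) :
    ∃ (y : Module.End ℂ V) (η : ℤ × ℤ → Module.End ℂ V),
      (Function.support η).Finite ∧
      (∀ pq : ℤ × ℤ, η pq ∈ gpq I pq.1 pq.2) ∧
      (∀ pq : ℤ × ℤ, 0 ≤ pq.1 + pq.2 → η pq = 0) ∧
      (∀ pq : ℤ × ℤ, 0 ≤ pq.1 → η pq = 0) ∧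
      (y = ∑ᶠ pq : ℤ × ℤ, η pq) ∧
      (∀ a : ℤ, Submodule.map (expEnd y) (Fdeg I a) =
        Submodule.map (expEnd b * expEnd x) (Fdeg I a)) ∧
      (∀ p : ℤ, 1 ≤ p → η (-p, p - 1) = ξ (-p, p - 1) + β (-p, p - 1)) ∧
      (∀ (y' : Module.End ℂ V) (η' : ℤ × ℤ → Module.End ℂ V),
        (Function.support η').Finite →
        (∀ pq : ℤ × ℤ, η' pq ∈ gpq I pq.1 pq.2) →
        (∀ pq : ℤ × ℤ, 0 ≤ pq.1 + pq.2 → η' pq = 0) →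
        (∀ pq : ℤ × ℤ, 0 ≤ pq.1 → η' pq = 0) →
        y' = ∑ᶠ pq : ℤ × ℤ, η' pq →
        (∀ a : ℤ, Submodule.map (expEnd y') (Fdeg I a) =
          Submodule.map (expEnd b * expEnd x) (Fdeg I a)) →
        y' = y) := by
  classical
  obtain ⟨e, S, h, hG⟩ := exists_ESys I hfin hInternal
  have hbA : b ∈ Afil e 1 := hb ▸ fam_mem h hG hβfin hβmem hβneg
  have hxA : x ∈ Afil e 1 := hx ▸ fam_mem h hG hξfin hξmem hξneg
  have hg : expEnd b * expEnd x - 1 ∈ Afil e 1 := by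
    have := Submodule.add_mem _ (Afil_anti (k := 1) (by omega) (h.g_sub hbA hxA))
      (Submodule.add_mem _ hbA hxA)
    rwa [sub_add_cancel] at this
  obtain ⟨y, hy, hyN, hy1⟩ : ∃ y ∈ Afil e 1, (∀ i j : ℤ × ℤ, j.1 ≤ i.1 → e i * y * e j = 0) ∧
      ∀ i j : ℤ × ℤ, i.1 < j.1 → e i * (expEnd (-y) * (expEnd b * expEnd x)) * e j = 0 := by
    obtain ⟨K, hK⟩ := h.exists_bot
    obtain ⟨y, hy, hyN, hy1⟩ := h.exists_y hg K
    refine ⟨y, hy, hyN, fun i j hij => ?_⟩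
    set T := expEnd (-y) * (expEnd b * expEnd x)
    have hz0 := hK (∑ i ∈ S, ∑ j ∈ S, if i.1 < j.1 then e i * T * e j else 0) (by
      intro i j hd
      rw [h.proj_entry (fun i j => i.1 < j.1)]
      split_ifs with hc
      · exact hy1 i j hc (by push_cast; omega)
      · rfl)
    have := h.proj_entry (fun i j => i.1 < j.1) T i j
    rw [hz0, if_pos hij] at this
    simpa using this.symm
  let η : ℤ × ℤ → Module.End ℂ V := fun p =>
    ∑ i ∈ S, ∑ j ∈ S, if i - j = p then e i * y * e j else 0
  have hηe : ∀ p i j, e i * η p * e j = if i - j = p then e i * y * e j else 0 :=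
    fun p i j => h.proj_entry (fun i j => i - j = p) y i j
  have hηfin : (Function.support η).Finite := by
    refine Set.Finite.subset ((S ×ˢ S).image (fun q => q.1 - q.2)).finite_toSet fun p hp => ?_
    by_contra hc
    refine hp (Finset.sum_eq_zero fun i hi => Finset.sum_eq_zero fun j hj => if_neg ?_)
    rintro rfl
    exact hc (Finset.mem_coe.2 (Finset.mem_image.2 ⟨(i, j), Finset.mk_mem_product hi hj, rfl⟩))
  have hηmem : ∀ pq : ℤ × ℤ, η pq ∈ gpq I pq.1 pq.2 := fun p =>
    (gpq_iff h hG p _).2 fun i j hij => by rw [hηe, if_neg hij]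
  refine ⟨y, η, hηfin, hηmem, ?_, ?_, ?_, (flag_iff h hG hbA hxA hy).2 hy1, ?_, ?_⟩
  · intro p hp
    refine h.ext0 fun i j => ?_
    rw [hηe]
    split_ifs with hc
    · subst hc
      simp only [Prod.fst_sub, Prod.snd_sub] at hp
      exact hy i j (by push_cast; omega)
    · rfl
  · intro p hp
    refine h.ext0 fun i j => ?_
    rw [hηe]
    split_ifs with hc
    · subst hc
      simp only [Prod.fst_sub] at hp
      exact hyN i j (by omega)
    · rfl
  · refine h.ext1 fun i j => ?_
    rw [entry_finsum h hG hηfin hηmem, hηe, if_pos rfl]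
  · intro p hp
    refine h.ext1 fun i j => ?_
    rw [hηe, mul_add, add_mul]
    split_ifs with hc
    · have h1 : i.1 - j.1 = -p := congrArg Prod.fst hc
      have h2 : i.2 - j.2 = p - 1 := congrArg Prod.snd hc
      rw [h.deg_one hbA hxA hg hy hy1 i j (by omega) (by omega), hb, hx,
        entry_finsum h hG hβfin hβmem, entry_finsum h hG hξfin hξmem, hc]
    · rw [(gpq_iff h hG _ _).1 (hξmem _) i j hc, (gpq_iff h hG _ _).1 (hβmem _) i j hc, add_zero]
  · intro y' η' hf hm hn hN hy' hflag
    have hyA' : y' ∈ Afil e 1 := hy' ▸ fam_mem h hG hf hm hn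
    exact h.unique_y hg hy hyA' hyN (fun i j hij => hy' ▸ fam_N h hG hf hm hN i j hij) hy1
      ((flag_iff h hG hbA hxA hyA').1 hflag)
end

section
/- Let V be a finite-dimensional vector space over a field of characteristic zero, N : V → V a nilpotent endomorphism, n ≥ 0 an integer, and W a weight filtration of N centered at n. For ℓ ∈ ℤ define U_ℓ = {ξ ∈ End(V) : ξ(W_k) ⊆ W_{k+ℓ} for all k}. Then U is the weight filtration of the nilpotent operator ad N : End(V) → End(V), ad N(ξ) = Nξ − ξN, centered at 0: (ad N)(U_ℓ) ⊆ U_{ℓ−2} for all ℓ, and for every k ≥ 0 the induced map (ad N)^k : U_k/U_{k−1} → U_{−k}/U_{−k−1} is an isomorphism. -/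
/-- A weight filtration centered at `0` of a nilpotent operator `f` on a space `E`,
indexed over `ℤ`: an increasing filtration `U` with `U ℓ = ⊥` for `ℓ` sufficiently
negative and `U ℓ = ⊤` for `ℓ` sufficiently positive, `f (U ℓ) ⊆ U (ℓ - 2)`, and such
that for every `k ≥ 0` the induced map `f ^ k : U k / U (k-1) → U (-k) / U (-k-1)` is an
isomorphism. -/
def IsWeightFiltrationAtZero {K E : Type*} [Field K] [AddCommGroup E] [Module K E]
    (f : Module.End K E) (U : ℤ → Submodule K E) : Prop :=
  Monotone U ∧
  (∃ a : ℤ, ∀ ℓ : ℤ, ℓ ≤ a → U ℓ = ⊥) ∧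
  (∃ b : ℤ, ∀ ℓ : ℤ, b ≤ ℓ → U ℓ = ⊤) ∧
  (∀ ℓ : ℤ, ∀ ξ ∈ U ℓ, f ξ ∈ U (ℓ - 2)) ∧
  (∀ k : ℕ,
    (∀ ξ ∈ U (k : ℤ), (f ^ k) ξ ∈ U (-(k : ℤ) - 1) → ξ ∈ U ((k : ℤ) - 1)) ∧
    (∀ η ∈ U (-(k : ℤ)), ∃ ξ ∈ U (k : ℤ), (f ^ k) ξ - η ∈ U (-(k : ℤ) - 1)))

/-- A filtration with a lowering operator `f`, a raising operator `e`, and `[e,f]` acting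
as `ℓ` on the graded pieces. -/
structure SlFilt {K M : Type*} [Field K] [AddCommGroup M] [Module K M]
    (f e : Module.End K M) (U : ℤ → Submodule K M) : Prop where
  mono : Monotone U
  bot : ∃ a : ℤ, ∀ ℓ : ℤ, ℓ ≤ a → U ℓ = ⊥
  top : ∃ b : ℤ, ∀ ℓ : ℤ, b ≤ ℓ → U ℓ = ⊤
  low : ∀ ℓ : ℤ, ∀ v ∈ U ℓ, f v ∈ U (ℓ - 2)
  up : ∀ ℓ : ℤ, ∀ v ∈ U ℓ, e v ∈ U (ℓ + 2)
  wt : ∀ ℓ : ℤ, ∀ v ∈ U ℓ, e (f v) - f (e v) - (ℓ : K) • v ∈ U (ℓ - 1)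

namespace SlFilt

variable {K M : Type*} [Field K] [AddCommGroup M] [Module K M]
  {f e : Module.End K M} {U : ℤ → Submodule K M}

theorem lowpow (h : SlFilt f e U) (s : ℕ) (m : ℤ) (x : M) (hx : x ∈ U m) :
    (f ^ s) x ∈ U (m - 2 * s) := by
  induction s with
  | zero => simpa using hx
  | succ s ih =>
    rw [pow_succ', Module.End.mul_apply]
    have := h.low _ _ ih
    convert this using 2
    push_cast; ring

theorem comm (h : SlFilt f e U) (t : ℕ) (m : ℤ) (x : M) (hx : x ∈ U m) :
    e ((f ^ (t + 1)) x) - (f ^ (t + 1)) (e x) - (((t + 1) * (m - t) : ℤ) : K) • (f ^ t) x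
      ∈ U (m - 2 * t - 1) := by
  induction t with
  | zero => simpa using h.wt m x hx
  | succ t ih =>
    have h1 := h.wt _ _ (h.lowpow (t + 1) m x hx)
    have h2 := h.low _ _ ih
    have h1' : _ ∈ U (m - 2 * ((t + 1 : ℕ) : ℤ) - 1) := h1
    have h2' : _ ∈ U (m - 2 * ((t + 1 : ℕ) : ℤ) - 1) :=
      (show m - 2 * (t : ℤ) - 1 - 2 = m - 2 * ((t + 1 : ℕ) : ℤ) - 1 by push_cast; ring) ▸ h2
    have h3 := add_mem h1' h2'
    convert h3 using 1
    have e1 : ∀ y, (f ^ (t + 1 + 1)) y = f ((f ^ (t + 1)) y) := fun y => by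
      rw [pow_succ', Module.End.mul_apply]
    have e2 : ∀ y, f ((f ^ t) y) = (f ^ (t + 1)) y := fun y => by
      rw [pow_succ' f t, Module.End.mul_apply]
    rw [e1, e1, map_sub, map_sub, map_smul, e2]
    push_cast
    module

theorem inj [CharZero K] (h : SlFilt f e U) (r : ℕ) :
    ∀ m : ℤ, (∀ ℓ : ℤ, m + r - 1 ≤ ℓ → U ℓ = ⊤) → ∀ s : ℕ, (s : ℤ) ≤ m → ∀ x ∈ U m,
      (f ^ s) x ∈ U (m - 2 * s - 1) → x ∈ U (m - 1) := by
  induction r with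
  | zero =>
    intro m hm s hs x hx _
    rw [hm (m - 1) (by simp)]; trivial
  | succ r ih =>
    intro m hm s
    induction s with
    | zero => intro hs x hx h0; simpa using h0
    | succ t iht =>
      intro hs x hx h0
      have hex : e x ∈ U (m + 2 - 1) := by
        refine ih (m + 2) (fun ℓ hl => hm ℓ (by push_cast; omega)) (t + 1 + 1)
          (by push_cast at *; omega) _ (h.up _ _ hx) ?_
        have h1 := h.comm (t + 1) m x hx
        have h2 := h.up _ _ (h.low _ _ h0)
        have h3 := (U (m - 2 * ((t + 1 : ℕ) : ℤ) - 1)).smul_mem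
          ((((((t + 1 : ℕ) : ℤ) + 1) * (m - ((t + 1 : ℕ) : ℤ)) : ℤ) : K)) h0
        have h2' : e (f ((f ^ (t + 1)) x)) ∈ U (m - 2 * ((t + 1 : ℕ) : ℤ) - 1) := by
          convert h2 using 2; ring
        rw [← Module.End.mul_apply f, ← pow_succ'] at h2'
        have h4 := sub_mem (sub_mem h2' h3) h1
        have e5 : m + 2 - 2 * ((t + 1 + 1 : ℕ) : ℤ) - 1 = m - 2 * ((t + 1 : ℕ) : ℤ) - 1 := by
          push_cast; ring
        rw [e5]
        convert h4 using 1
        abel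
      apply iht (by push_cast at hs; omega) x hx
      have h1 := h.comm t m x hx
      have h2 := h.up _ _ h0
      have h3 := h.lowpow (t + 1) _ _ hex
      have h2' : e ((f ^ (t + 1)) x) ∈ U (m - 2 * t - 1) := by
        convert h2 using 2; push_cast; ring
      have h3' : (f ^ (t + 1)) (e x) ∈ U (m - 2 * t - 1) := by
        convert h3 using 2; push_cast; ring
      have h4 := sub_mem (sub_mem h2' h3') h1
      rw [sub_sub_cancel] at h4
      refine ((U (m - 2 * t - 1)).smul_mem_iff ?_).1 h4
      push_cast at hs
      have a1 : ((t : ℤ) + 1) ≠ 0 := by omega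
      have a2 : m - (t : ℤ) ≠ 0 := by omega
      exact_mod_cast mul_ne_zero a1 a2

theorem surj [CharZero K] (h : SlFilt f e U) (r : ℕ) :
    ∀ j : ℤ, (∀ ℓ : ℤ, ℓ ≤ j - r → U ℓ = ⊥) → ∀ s : ℕ, (s : ℤ) ≤ -j → ∀ y ∈ U j,
      ∃ z ∈ U (j + 2 * s), (f ^ s) z - y ∈ U (j - 1) := by
  induction r using Nat.strong_induction_on with
  | _ r ih =>
    intro j hj s
    rcases Nat.eq_zero_or_pos r with rfl | hr
    · intro _ y hy
      rw [hj j (by simp)] at hy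
      rw [Submodule.mem_bot] at hy
      exact ⟨0, zero_mem _, by simp [hy]⟩
    induction s with
    | zero => intro _ y hy; exact ⟨y, by simpa using hy, by simp⟩
    | succ t iht =>
      intro hs y hy
      obtain ⟨z, hz, hzy⟩ := ih (r - 1) (by omega) (j - 2) (fun ℓ hl => hj ℓ (by omega)) (t + 2)
        (by push_cast at *; omega) _ (h.low _ _ hy)
      have hz' : z ∈ U (j + 2 * ((t + 1 : ℕ) : ℤ)) := by
        convert hz using 2; push_cast; ring
      have hfz : (f ^ (t + 1)) z ∈ U j := by
        have := h.lowpow (t + 1) _ _ hz'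
        convert this using 2; ring
      obtain ⟨w, hw, hwy⟩ := iht (by push_cast at hs; omega) (y - (f ^ (t + 1)) z)
        (sub_mem hy hfz)
      have h1 := h.comm t _ _ hw
      have ej : j + 2 * (t : ℤ) - 2 * t - 1 = j - 1 := by ring
      have ej' : j + 2 * (t : ℤ) - t = j + t := by ring
      rw [ej, ej'] at h1
      set c : K := (((t + 1) * (j + t) : ℤ) : K) with hc
      have hc0 : c ≠ 0 := by
        push_cast at hs
        have a1 : ((t : ℤ) + 1) ≠ 0 := by omega
        have a2 : j + (t : ℤ) ≠ 0 := by omega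
        rw [hc]
        exact_mod_cast mul_ne_zero a1 a2
      -- e f^{t+1} w is small
      have h2 : e ((f ^ (t + 1)) w) ∈ U (j - 1) := by
        have q1 := h.low _ _ hwy
        have q1' : f ((f ^ t) w - (y - (f ^ (t + 1)) z)) ∈ U (j - 2 - 1) := by
          convert q1 using 2; ring
        have q2 := sub_mem q1' hzy
        have q3 : (f ^ (t + 1)) w ∈ U (j - 2 - 1) := by
          convert q2 using 1
          rw [map_sub, map_sub, pow_succ' f t, pow_succ' f (t + 1), pow_succ' f t]
          simp only [Module.End.mul_apply]
          abel
        have q4 := h.up _ _ q3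
        convert q4 using 2; ring
      refine ⟨z + (-c⁻¹) • e w, add_mem hz' (Submodule.smul_mem _ _ ?_), ?_⟩
      · have := h.up _ _ hw
        convert this using 2; push_cast; ring
      · have q := add_mem (Submodule.smul_mem _ c⁻¹ (sub_mem h1 h2)) hwy
        convert q using 1
        rw [map_add, map_smul, smul_sub, smul_sub, smul_sub, smul_smul, inv_mul_cancel₀ hc0]
        module

theorem weight [CharZero K] (h : SlFilt f e U) : IsWeightFiltrationAtZero f U := by
  refine ⟨h.mono, h.bot, h.top, h.low, fun k => ⟨?_, ?_⟩⟩
  · intro ξ hξ h0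
    obtain ⟨b, hb⟩ := h.top
    refine h.inj (b - k + 1).toNat k (fun ℓ hl => hb ℓ (by omega)) k le_rfl ξ hξ ?_
    convert h0 using 2; ring
  · intro η hη
    obtain ⟨a, ha⟩ := h.bot
    obtain ⟨z, hz, hz'⟩ := h.surj (-k - a).toNat (-k) (fun ℓ hl => ha ℓ (by omega)) k (by simp) η hη
    exact ⟨z, by convert hz using 2; ring, hz'⟩

end SlFilt

/-- Uniqueness of the weight filtration. -/
theorem weight_le {K M : Type*} [Field K] [AddCommGroup M] [Module K M]
    {f : Module.End K M} {U U' : ℤ → Submodule K M}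
    (h : IsWeightFiltrationAtZero f U) (h' : IsWeightFiltrationAtZero f U') : U = U' := by
  obtain ⟨mU0, ⟨a, ha⟩, ⟨b, hb⟩, hl, hk⟩ := h
  obtain ⟨mU0', ⟨a', ha'⟩, ⟨b', hb'⟩, hl', hk'⟩ := h'
  have lp : ∀ (V : ℤ → Submodule K M), (∀ ℓ : ℤ, ∀ ξ ∈ V ℓ, f ξ ∈ V (ℓ - 2)) →
      ∀ (s : ℕ) (m : ℤ) (x : M), x ∈ V m → (f ^ s) x ∈ V (m - 2 * s) := by
    intro V hV s m x hx
    induction s with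
    | zero => simpa using hx
    | succ s ih =>
      rw [pow_succ', Module.End.mul_apply]
      have := hV _ _ ih
      convert this using 2
      push_cast; ring
  obtain ⟨B, hB⟩ : ∃ B : ℕ, b ≤ B ∧ b' ≤ B ∧ -(B : ℤ) ≤ a ∧ -(B : ℤ) ≤ a' :=
    ⟨(max (max b b') (max (-a) (-a'))).toNat, by omega⟩
  have aux : ∀ (V V' : ℤ → Submodule K M), (∀ ℓ : ℤ, ∀ ξ ∈ V ℓ, f ξ ∈ V (ℓ - 2)) →
      (∀ k : ℕ,
    (∀ ξ ∈ V' (k : ℤ), (f ^ k) ξ ∈ V' (-(k : ℤ) - 1) → ξ ∈ V' ((k : ℤ) - 1))) →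
      ∀ k : ℕ, V k = V' k → V (-(k : ℤ) - 1) = V' (-(k : ℤ) - 1) → Monotone V →
      V ((k : ℤ) - 1) ≤ V' ((k : ℤ) - 1) := by
    intro V V' hV hV' k e1 e2 hm x hx
    apply hV' k x (e1 ▸ hm (by omega) hx)
    rw [← e2]
    have := lp V hV k _ _ hx
    convert this using 2; ring
  have aux2 : ∀ (V V' : ℤ → Submodule K M), (∀ ℓ : ℤ, ∀ ξ ∈ V' ℓ, f ξ ∈ V' (ℓ - 2)) →
      (∀ k : ℕ,
    (∀ η ∈ V (-(k : ℤ)), ∃ ξ ∈ V (k : ℤ), (f ^ k) ξ - η ∈ V (-(k : ℤ) - 1))) →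
      ∀ k : ℕ, V k = V' k → V (-(k : ℤ) - 1) = V' (-(k : ℤ) - 1) → Monotone V' →
      V (-(k : ℤ)) ≤ V' (-(k : ℤ)) := by
    intro V V' hV hV' k e1 e2 hm x hx
    obtain ⟨ξ, hξ, hx'⟩ := hV' k x hx
    have q1 : (f ^ k) ξ ∈ V' (-(k : ℤ)) := by
      have := lp V' hV k _ _ (e1 ▸ hξ)
      convert this using 2; ring
    have q2 := hm (show -(k : ℤ) - 1 ≤ -k by omega) (e2 ▸ hx')
    have := sub_mem q1 q2
    simpa using this
  have main : ∀ r : ℕ, ∀ k : ℕ, B ≤ k + r → U k = U' k ∧ U (-(k : ℤ) - 1) = U' (-(k : ℤ) - 1) := by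
    intro r
    induction r with
    | zero =>
      intro k hk0
      rw [hb _ (by omega), hb' _ (by omega), ha _ (by omega), ha' _ (by omega)]
      simp
    | succ r ih =>
      intro k hk0
      obtain ⟨i1, i2⟩ := ih (k + 1) (by omega)
      have mU := mU0
      have mU' := mU0'
      have t1 := le_antisymm (aux U U' hl (fun k => (hk' k).1) (k + 1) i1 i2 mU)
        (aux U' U hl' (fun k => (hk k).1) (k + 1) i1.symm i2.symm mU')
      have t2 := le_antisymm (aux2 U U' hl' (fun k => (hk k).2) (k + 1) i1 i2 mU')
        (aux2 U' U hl (fun k => (hk' k).2) (k + 1) i1.symm i2.symm mU)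
      have c1 : ((k + 1 : ℕ) : ℤ) - 1 = k := by push_cast; ring
      have c2 : -((k + 1 : ℕ) : ℤ) = -(k : ℤ) - 1 := by push_cast; ring
      rw [c1] at t1
      rw [c2] at t2
      exact ⟨t1, t2⟩
  funext ℓ
  rcases le_or_gt 0 ℓ with h0 | h0
  · have := (main B ℓ.toNat (by omega)).1
    rwa [Int.toNat_of_nonneg h0] at this
  · have := (main B (-ℓ - 1).toNat (by omega)).2
    rw [Int.toNat_of_nonneg (by omega)] at this
    have c : -(-ℓ - 1) - 1 = ℓ := by ring
    rwa [c] at this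

open Polynomial in
theorem exists_gen {K V : Type*} [Field K] [AddCommGroup V] [Module K V] [FiniteDimensional K V]
    (N : Module.End K V) (hN : IsNilpotent N) :
    ∃ (d : ℕ) (k : Fin d → ℕ) (φ : (Fin d → K[X]) →ₗ[K] V), Function.Surjective φ ∧
      (∀ p, φ ((X : K[X]) • p) = N (φ p)) ∧ (∀ p, φ p = 0 ↔ ∀ i, X ^ (k i) ∣ p i) := by
  obtain ⟨r, hr⟩ := hN
  have ht : Module.IsTorsion' (Module.AEval' N) (Submonoid.powers (X : K[X])) := by
    intro x
    refine ⟨⟨X ^ r, ⟨r, rfl⟩⟩, ?_⟩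
    obtain ⟨v, rfl⟩ := (Module.AEval'.of N).surjective x
    have := Module.AEval'.X_pow_smul_of N v r
    rw [hr] at this
    rw [zero_smul, map_zero] at this
    exact this
  obtain ⟨d, k, ⟨e⟩⟩ := Module.torsion_by_prime_power_decomposition
    (Polynomial.irreducible_X (R := K)) ht
  let e2 := DirectSum.linearEquivFunOnFintype K[X] (Fin d) (fun i => K[X] ⧸ K[X] ∙ (X : K[X]) ^ (k i))
  let e3 := e.trans e2
  let ψ : (Fin d → K[X]) →ₗ[K[X]] (∀ i : Fin d, K[X] ⧸ K[X] ∙ (X : K[X]) ^ (k i)) :=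
    LinearMap.pi fun i => (Submodule.mkQ _) ∘ₗ LinearMap.proj i
  have hψ : Function.Surjective ψ := by
    intro y
    choose p hp using fun i => Submodule.mkQ_surjective _ (y i)
    exact ⟨p, funext hp⟩
  let φ0 : (Fin d → K[X]) →ₗ[K[X]] Module.AEval' N := e3.symm.toLinearMap ∘ₗ ψ
  refine ⟨d, k, (Module.AEval'.of N).symm.toLinearMap ∘ₗ φ0.restrictScalars K, ?_, ?_, ?_⟩
  · exact (Module.AEval'.of N).symm.surjective.comp (e3.symm.surjective.comp hψ)
  · intro p
    have : φ0 ((X : K[X]) • p) = (X : K[X]) • φ0 p := map_smul _ _ _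
    simp only [LinearMap.comp_apply, LinearMap.restrictScalars_apply, this]
    exact Module.AEval'.of_symm_X_smul N _
  · intro p
    simp only [LinearMap.comp_apply, LinearMap.restrictScalars_apply, LinearEquiv.coe_coe,
      LinearEquiv.map_eq_zero_iff, φ0]
    rw [funext_iff]
    refine forall_congr' fun i => ?_
    change Submodule.mkQ _ (p i) = 0 ↔ _
    rw [Submodule.mkQ_apply, Submodule.Quotient.mk_eq_zero, ← Ideal.mem_span_singleton]

open Polynomial in
theorem exists_slFilt {K V : Type*} [Field K] [AddCommGroup V] [Module K V]
    [FiniteDimensional K V] (N : Module.End K V) (hN : IsNilpotent N) :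
    ∃ (E : Module.End K V) (F : ℤ → Submodule K V), SlFilt N E F := by
  obtain ⟨d, k, φ, hs, hX, hker⟩ := exists_gen N hN
  -- raising operator on polynomials
  let e0 : Fin d → (K[X] →ₗ[K] K[X]) := fun i =>
    ((k i : K) - 1) • (Polynomial.derivative : K[X] →ₗ[K] K[X]) -
      (LinearMap.mulLeft K (X : K[X])) ∘ₗ Polynomial.derivative ∘ₗ Polynomial.derivative
  have e0X : ∀ (i : Fin d) (j : ℕ), e0 i (X ^ j) = ((j : K) * (k i - j)) • X ^ (j - 1) := by
    intro i j
    rcases j with _ | _ | j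
    · simp [e0]
    · simp [e0]
    · simp only [e0, LinearMap.sub_apply, LinearMap.smul_apply, LinearMap.comp_apply,
        LinearMap.mulLeft_apply, Polynomial.derivative_X_pow, Polynomial.smul_eq_C_mul,
        Polynomial.derivative_C_mul]
      simp only [Nat.add_sub_cancel, map_sub, map_mul, map_natCast, map_one, map_add, Nat.cast_add,
        Nat.cast_one]
      ring
  have e0dvd : ∀ i p, X ^ (k i) ∣ p → X ^ (k i) ∣ e0 i p := by
    rintro i _ ⟨q, rfl⟩
    induction q using Polynomial.induction_on' with
    | add p q hp hq => rw [mul_add, map_add]; exact dvd_add hp hq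
    | monomial j a =>
      rw [← Polynomial.C_mul_X_pow_eq_monomial, mul_left_comm, ← pow_add,
        ← Polynomial.smul_eq_C_mul, map_smul, e0X]
      rcases j with _ | j
      · simp
      · rw [Polynomial.smul_eq_C_mul, Polynomial.smul_eq_C_mul]
        exact Dvd.dvd.mul_left (Dvd.dvd.mul_left (pow_dvd_pow _ (by omega)) _) _
  let e1 : (Fin d → K[X]) →ₗ[K] (Fin d → K[X]) := LinearMap.pi fun i => e0 i ∘ₗ LinearMap.proj i
  obtain ⟨σ, hσ⟩ := φ.exists_rightInverse_of_surjective (LinearMap.range_eq_top.2 hs)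
  have hσ' : ∀ v, φ (σ v) = v := fun v => LinearMap.congr_fun hσ v
  let E : Module.End K V := φ ∘ₗ e1 ∘ₗ σ
  have hE : ∀ p, E (φ p) = φ (e1 p) := by
    intro p
    change φ (e1 (σ (φ p))) = _
    rw [← sub_eq_zero, ← map_sub, ← map_sub, hker]
    intro i
    apply e0dvd
    have : φ (σ (φ p) - p) = 0 := by rw [map_sub, hσ', sub_self]
    exact (hker _).1 this i
  let g : Fin d → ℕ → V := fun i j => φ (Pi.single i (X ^ j))
  have gN : ∀ i j, N (g i j) = g i (j + 1) := by
    intro i j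
    simp only [g]
    rw [← hX, ← Pi.single_smul, smul_eq_mul, ← pow_succ']
  have gE : ∀ i j, E (g i j) = ((j : K) * (k i - j)) • g i (j - 1) := by
    intro i j
    simp only [g]
    rw [hE, ← map_smul, ← Pi.single_smul, ← e0X]
    congr 1
    funext i'
    by_cases h : i' = i
    · subst h; simp [e1]
    · simp [e1, h]
  have g0 : ∀ i j, k i ≤ j → g i j = 0 := by
    intro i j hj
    rw [hker]
    intro i'
    by_cases h : i' = i
    · subst h; simpa using pow_dvd_pow _ hj
    · simp [h]
  have gtop : ∀ v, v ∈ Submodule.span K (Set.range fun x : Fin d × ℕ => g x.1 x.2) := by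
    intro v
    obtain ⟨p, rfl⟩ := hs v
    rw [← Finset.univ_sum_single p, map_sum]
    refine Submodule.sum_mem _ fun i _ => ?_
    induction p i using Polynomial.induction_on' with
    | add p q hp hq => rw [Pi.single_add, map_add]; exact add_mem hp hq
    | monomial j a =>
      rw [← Polynomial.C_mul_X_pow_eq_monomial, ← Polynomial.smul_eq_C_mul, Pi.single_smul,
        map_smul]
      exact Submodule.smul_mem _ _ (Submodule.subset_span ⟨(i, j), rfl⟩)
  let F : ℤ → Submodule K V := fun ℓ =>
    Submodule.span K {v | ∃ (i : Fin d) (j : ℕ), (k i : ℤ) - 1 - 2 * j ≤ ℓ ∧ v = g i j}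
  have gF : ∀ (i : Fin d) (j : ℕ) (ℓ : ℤ), (k i : ℤ) - 1 - 2 * j ≤ ℓ → g i j ∈ F ℓ := fun i j ℓ h =>
    Submodule.subset_span ⟨i, j, h, rfl⟩
  have hF : ∀ ℓ (T : Module.End K V) (S : Submodule K V),
      (∀ (i : Fin d) (j : ℕ), (k i : ℤ) - 1 - 2 * j ≤ ℓ → T (g i j) ∈ S) → ∀ v ∈ F ℓ, T v ∈ S := by
    intro ℓ T S h
    have : F ℓ ≤ S.comap T := by
      rw [Submodule.span_le]
      rintro _ ⟨i, j, hij, rfl⟩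
      exact h i j hij
    exact this
  obtain ⟨B, hB⟩ : ∃ B : ℕ, ∀ i, k i ≤ B :=
    ⟨∑ i, k i, fun i => Finset.single_le_sum (f := k) (fun _ _ => Nat.zero_le _) (Finset.mem_univ i)⟩
  refine ⟨E, F, ?_, ⟨-B - 1, ?_⟩, ⟨B, ?_⟩, ?_, ?_, ?_⟩
  · intro a b hab v hv
    exact hF a LinearMap.id (F b) (fun i j h => gF i j b (h.trans hab)) v hv
  · intro ℓ hl
    rw [eq_bot_iff]
    refine fun v hv => hF ℓ LinearMap.id ⊥ (fun i j h => ?_) v hv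
    have := hB i
    rw [LinearMap.id_apply, g0 i j (by omega)]
    exact zero_mem _
  · intro ℓ hl
    rw [eq_top_iff]
    intro v _
    refine Submodule.span_le.2 ?_ (gtop v)
    rintro _ ⟨⟨i, j⟩, rfl⟩
    have := hB i
    exact gF i j ℓ (by omega)
  · intro ℓ
    refine hF ℓ N _ fun i j h => ?_
    rw [gN]
    exact gF _ _ _ (by push_cast; omega)
  · intro ℓ
    refine hF ℓ E _ fun i j h => ?_
    rw [gE]
    rcases j with _ | j
    · simp
    · exact Submodule.smul_mem _ _ (gF _ _ _ (by push_cast at *; simp; omega))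
  · intro ℓ
    refine hF ℓ (E * N - N * E - (ℓ : K) • 1) _ fun i j h => ?_
    have key : (E * N - N * E - (ℓ : K) • 1) (g i j) = (((k i : ℤ) - 1 - 2 * j - ℓ : ℤ) : K) • g i j := by
      simp only [LinearMap.sub_apply, Module.End.mul_apply, LinearMap.smul_apply,
        Module.End.one_apply, gN, gE, map_smul]
      rcases j with _ | j
      · simp; module
      · simp only [Nat.add_sub_cancel]
        push_cast
        module
    rw [key]
    rcases h.lt_or_eq with h | h
    · exact Submodule.smul_mem _ _ (gF _ _ _ (by omega))
    · rw [h]; simp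

/-- The filtration `U ℓ = {ξ ∈ End V | ξ (W k) ⊆ W (k + ℓ) for all k}` induced on `End V`
by a weight filtration `W` of `N` centered at `n` is the weight filtration of
`ad N : ξ ↦ N ξ - ξ N` centered at `0`. -/
theorem induced_filtration_on_End_is_weight_filtration_of_adN
    {K V : Type*} [Field K] [CharZero K]
    [AddCommGroup V] [Module K V] [FiniteDimensional K V]
    (N : V →ₗ[K] V) (hN : IsNilpotent N) (n : ℕ)
    (W : ℤ → Submodule K V) (hW : IsWeightFiltration N n W)
    (U : ℤ → Submodule K (Module.End K V))
    (hU : ∀ ℓ : ℤ, ∀ ξ : Module.End K V,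
      ξ ∈ U ℓ ↔ ∀ k : ℤ, ∀ v ∈ W k, ξ v ∈ W (k + ℓ)) :
    IsWeightFiltrationAtZero (LinearMap.mulLeft K N - LinearMap.mulRight K N) U := by
  obtain ⟨E, F, hF⟩ := exists_slFilt N hN
  have hFW : ∀ ℓ, W ((n : ℤ) + ℓ) = F ℓ := by
    have : (fun ℓ => W ((n : ℤ) + ℓ)) = F := by
      refine weight_le (f := N) ?_ hF.weight
      obtain ⟨h1, h2, h3, h4, h5⟩ := hW
      refine ⟨fun a b hab => h1 (by omega), ⟨-n - 1, fun ℓ hl => h2 _ (by omega)⟩,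
        ⟨n, fun ℓ hl => h3 _ (by omega)⟩, fun ℓ v hv => ?_, fun k => ⟨fun v hv h => ?_, fun w hw => ?_⟩⟩
      · have := h4 _ v hv
        convert this using 2; ring
      · have := (h5 k).1 v hv (by convert h using 2; ring)
        convert this using 2; ring
      · obtain ⟨v, hv, hv'⟩ := (h5 k).2 w (by convert hw using 2; ring)
        exact ⟨v, hv, by convert hv' using 2; ring⟩
    exact fun ℓ => congrFun this ℓ
  have hU' : ∀ ℓ : ℤ, ∀ ξ : Module.End K V,
      ξ ∈ U ℓ ↔ ∀ k : ℤ, ∀ v ∈ F k, ξ v ∈ F (k + ℓ) := by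
    intro ℓ ξ
    rw [hU]
    constructor
    · intro h k v hv
      rw [← hFW] at hv ⊢
      rw [← add_assoc]
      exact h _ v hv
    · intro h k v hv
      have e1 : W k = F (k - n) := by rw [← hFW]; congr 1; ring
      have e2 : W (k + ℓ) = F (k - n + ℓ) := by rw [← hFW]; congr 1; ring
      rw [e1] at hv
      rw [e2]
      exact h _ v hv
  clear hU hFW hW
  obtain ⟨hm, ⟨a, ha⟩, ⟨b, hb⟩, hlow, hup, hwt⟩ := hF
  refine SlFilt.weight (e := LinearMap.mulLeft K E - LinearMap.mulRight K E)
    ⟨?_, ⟨a - b, ?_⟩, ⟨b - a, ?_⟩, ?_, ?_, ?_⟩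
  · intro i j hij ξ hξ
    rw [hU'] at hξ ⊢
    exact fun k v hv => hm (by omega) (hξ k v hv)
  · intro ℓ hl
    rw [eq_bot_iff]
    intro ξ hξ
    rw [hU'] at hξ
    rw [Submodule.mem_bot]
    ext v
    have := hξ b v (by rw [hb b le_rfl]; trivial)
    rw [ha _ (by omega)] at this
    simpa using this
  · intro ℓ hl
    rw [eq_top_iff]
    intro ξ _
    rw [hU']
    intro k v hv
    rcases le_or_gt k a with h | h
    · rw [ha k h, Submodule.mem_bot] at hv
      simp [hv]
    · rw [hb _ (by omega)]; trivial
  · intro ℓ ξ hξ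
    rw [hU'] at hξ ⊢
    intro k v hv
    have h1 := hlow _ _ (hξ k v hv)
    have h2 := hξ _ _ (hlow _ _ hv)
    have h1' : N (ξ v) ∈ F (k + (ℓ - 2)) := by convert h1 using 2; ring
    have h2' : ξ (N v) ∈ F (k + (ℓ - 2)) := by convert h2 using 2; ring
    exact sub_mem h1' h2'
  · intro ℓ ξ hξ
    rw [hU'] at hξ ⊢
    intro k v hv
    have h1 := hup _ _ (hξ k v hv)
    have h2 := hξ _ _ (hup _ _ hv)
    have h1' : E (ξ v) ∈ F (k + (ℓ + 2)) := by convert h1 using 2; ring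
    have h2' : ξ (E v) ∈ F (k + (ℓ + 2)) := by convert h2 using 2; ring
    exact sub_mem h1' h2'
  · intro ℓ ξ hξ
    rw [hU'] at hξ ⊢
    intro k v hv
    have h1 := hwt _ _ (hξ k v hv)
    have h2 := hξ _ _ (hwt _ _ hv)
    have h1' : E (N (ξ v)) - N (E (ξ v)) - ((k + ℓ : ℤ) : K) • ξ v ∈ F (k + (ℓ - 1)) := by
      convert h1 using 2; ring
    have h2' : ξ (E (N v) - N (E v) - (k : K) • v) ∈ F (k + (ℓ - 1)) := by
      convert h2 using 2; ring
    have := sub_mem h1' h2'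
    convert this using 1
    simp only [LinearMap.sub_apply, LinearMap.mulLeft_apply, LinearMap.mulRight_apply,
      Module.End.mul_apply, LinearMap.smul_apply, map_sub, map_smul]
    push_cast
    module
end
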